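/- arXiv:2206.04175 — 4 statements merged into one kernel-verified Lean document; each statement's English description precedes it below -/
import Mathlib

section
/- Let P ⊂ ℝ^d be a full-dimensional rational polytope with denominator q and let ℓ be the smallest positive integer such that the interior of ℓP contains a lattice point; let x ∈ P° satisfy ℓx ∈ ℤ^d. Let Δ ⊂ ∂P be a half-open (d−1)-simplex with vertices v_1, …, v_d ∈ (1/q)ℤ^d in which exactly the facets opposite v_1, …, v_r are removed, and let Pyr(x,Δ) be the half-open d-simplex with vertices v_1, …, v_d, x in which exactly the facets opposite v_1, …, v_r are removed. Define h*_Δ(z) := (1−z^q)^d · Σ_{m ∈ hom(Δ) ∩ ℤ^{d+1}} z^{m_{d+1}} and h*_{Pyr(x,Δ)}(z) := (1−z^q)^d (1−z^ℓ) · Σ_{m ∈ hom(Pyr(x,Δ)) ∩ ℤ^{d+1}} z^{m_{d+1}}. Then h*_{Pyr(x,Δ)}(z) = h*_Δ(z) + z^ℓ·b_Δ(z) for some polynomial b_Δ(z) with nonnegative integer coefficients. -/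
open Pointwise

/-- `x ∈ ℤ^d`, i.e. every coordinate of `x` is an integer. -/
def IsLatticePt {d : ℕ} (x : Fin d → ℝ) : Prop := ∀ i, ∃ a : ℤ, x i = (a : ℝ)

/-- `x ∈ ℚ^d`, i.e. every coordinate of `x` is rational. -/
def IsRationalPt {d : ℕ} (x : Fin d → ℝ) : Prop := ∀ i, ∃ a : ℚ, x i = (a : ℝ)

/-- `P` is a lattice polytope: the convex hull of finitely many points of `ℤ^d`. -/
def IsLatticePolytope {d : ℕ} (P : Set (Fin d → ℝ)) : Prop :=
  ∃ V : Finset (Fin d → ℝ), (∀ v ∈ V, IsLatticePt v) ∧ P = convexHull ℝ (V : Set (Fin d → ℝ))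

/-- `P` is a rational polytope: the convex hull of finitely many points of `ℚ^d`. -/
def IsRationalPolytope {d : ℕ} (P : Set (Fin d → ℝ)) : Prop :=
  ∃ V : Finset (Fin d → ℝ), (∀ v ∈ V, IsRationalPt v) ∧ P = convexHull ℝ (V : Set (Fin d → ℝ))

/-- A convex subset of `ℝ^d` is full-dimensional iff its interior is nonempty. -/
def IsFullDim {d : ℕ} (P : Set (Fin d → ℝ)) : Prop := (interior P).Nonempty

/-- The number of lattice points in `S`. -/
noncomputable def latCount {d : ℕ} (S : Set (Fin d → ℝ)) : ℕ :=
  Set.ncard {x ∈ S | IsLatticePt x}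

/-- The Ehrhart series `Ehr_P(z) = 1 + ∑_{n ≥ 1} #(nP ∩ ℤ^d) zⁿ`. -/
noncomputable def ehrSeries {d : ℕ} (P : Set (Fin d → ℝ)) : PowerSeries ℤ :=
  PowerSeries.mk fun n => if n = 0 then 1 else (latCount ((n : ℝ) • P) : ℤ)

/-- The interior Ehrhart series `∑_{n ≥ 1} #(nP° ∩ ℤ^d) zⁿ`. -/
noncomputable def ehrIntSeries {d : ℕ} (P : Set (Fin d → ℝ)) : PowerSeries ℤ :=
  PowerSeries.mk fun n => if n = 0 then 0 else (latCount (interior ((n : ℝ) • P)) : ℤ)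

/-- The boundary Ehrhart series `1 + ∑_{n ≥ 1} #(n ∂P ∩ ℤ^d) zⁿ`. -/
noncomputable def ehrBdSeries {d : ℕ} (P : Set (Fin d → ℝ)) : PowerSeries ℤ :=
  PowerSeries.mk fun n => if n = 0 then 1 else (latCount (frontier ((n : ℝ) • P)) : ℤ)

/-- `q` is the denominator of `P`: the smallest positive integer such that `qP` is a
lattice polytope. -/
def IsDenominator {d : ℕ} (P : Set (Fin d → ℝ)) (q : ℕ) : Prop :=
  0 < q ∧ IsLatticePolytope ((q : ℝ) • P) ∧
    ∀ k : ℕ, 0 < k → IsLatticePolytope ((k : ℝ) • P) → q ≤ k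

/-- `l` is the smallest positive integer such that the interior of `lP` contains a
lattice point. -/
def IsMinInteriorDilate {d : ℕ} (P : Set (Fin d → ℝ)) (l : ℕ) : Prop :=
  0 < l ∧ (∃ x, IsLatticePt x ∧ x ∈ interior ((l : ℝ) • P)) ∧
    ∀ k : ℕ, 0 < k → (∃ x, IsLatticePt x ∧ x ∈ interior ((k : ℝ) • P)) → l ≤ k

/-- The homogenization of the half-open simplex with vertices `w 0, …, w (k-1)`
where the facets opposite the first `r` vertices are removed:
`hom(Δ) = Σ_{j<r} ℝ_{>0} (w j, 1) + Σ_{j≥r} ℝ_{≥0} (w j, 1) ⊆ ℝ^{d+1}`. -/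
def homog {d k : ℕ} (w : Fin k → (Fin d → ℝ)) (r : ℕ) : Set (Fin (d + 1) → ℝ) :=
  {y | ∃ c : Fin k → ℝ, (∀ j : Fin k, (j : ℕ) < r → 0 < c j) ∧
    (∀ j : Fin k, r ≤ (j : ℕ) → 0 ≤ c j) ∧
    y = ∑ j : Fin k, c j • (Fin.snoc (w j) 1 : Fin (d + 1) → ℝ)}

/-- The fundamental parallelepiped
`F'_Δ = Σ_{j<r} (0,1] (q_j w_j, q_j) + Σ_{j≥r} [0,1) (q_j w_j, q_j) ⊆ ℝ^{d+1}`. -/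
def fpar {d k : ℕ} (w : Fin k → (Fin d → ℝ)) (r : ℕ) (q : Fin k → ℕ) :
    Set (Fin (d + 1) → ℝ) :=
  {y | ∃ c : Fin k → ℝ, (∀ j : Fin k, (j : ℕ) < r → c j ∈ Set.Ioc (0 : ℝ) 1) ∧
    (∀ j : Fin k, r ≤ (j : ℕ) → c j ∈ Set.Ico (0 : ℝ) 1) ∧
    y = ∑ j : Fin k, c j • ((q j : ℝ) • (Fin.snoc (w j) 1 : Fin (d + 1) → ℝ))}

/-- The generating function `∑_{x ∈ S ∩ ℤ^{d+1}} z^{x_{d+1}}` of a subset `S ⊆ ℝ^{d+1}`,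
graded by the last coordinate. -/
noncomputable def sliceSeries {d : ℕ} (S : Set (Fin (d + 1) → ℝ)) : PowerSeries ℤ :=
  PowerSeries.mk fun n =>
    (Set.ncard {y ∈ S | IsLatticePt y ∧ y (Fin.last d) = (n : ℝ)} : ℤ)

/-- A polynomial is palindromic if `z^{deg f} f(1/z) = f(z)`,
i.e. `f_i = f_{deg f − i}` for all `i ≤ deg f`. -/
def IsPalin (f : Polynomial ℤ) : Prop :=
  ∀ i ≤ f.natDegree, f.coeff i = f.coeff (f.natDegree - i)

/-- `P` is rational reflexive: the origin is an interior point and `P = {x : A x ≤ 𝟙}`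
for some integer matrix `A`. -/
def IsRationalReflexive {d : ℕ} (P : Set (Fin d → ℝ)) : Prop :=
  IsRationalPolytope P ∧ (0 : Fin d → ℝ) ∈ interior P ∧
    ∃ (m : ℕ) (A : Fin m → Fin d → ℤ),
      P = {x : Fin d → ℝ | ∀ j, (∑ i, (A j i : ℝ) * x i) ≤ 1}

/-- `P` is a reflexive (lattice) polytope. -/
def IsReflexive {d : ℕ} (P : Set (Fin d → ℝ)) : Prop :=
  IsLatticePolytope P ∧ (0 : Fin d → ℝ) ∈ interior P ∧
    ∃ (m : ℕ) (A : Fin m → Fin d → ℤ),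
      P = {x : Fin d → ℝ | ∀ j, (∑ i, (A j i : ℝ) * x i) ≤ 1}

/-- `P` is an integral translate of a reflexive polytope. -/
def IsTranslatedReflexive {d : ℕ} (P : Set (Fin d → ℝ)) : Prop :=
  ∃ (Q : Set (Fin d → ℝ)) (t : Fin d → ℤ), IsReflexive Q ∧
    P = (fun y => y + fun i => (t i : ℝ)) '' Q

/-- The rational Ehrhart series `1 + ∑_{n ≥ 1} #((n/r) P ∩ ℤ^d) wⁿ`. -/
noncomputable def ratEhrSeries {d : ℕ} (P : Set (Fin d → ℝ)) (r : ℕ) : PowerSeries ℤ :=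
  PowerSeries.mk fun n => if n = 0 then 1 else (latCount (((n : ℝ) / (r : ℝ)) • P) : ℤ)

/-- The rational boundary Ehrhart series `1 + ∑_{n ≥ 1} #((n/r) ∂P ∩ ℤ^d) wⁿ`. -/
noncomputable def ratEhrBdSeries {d : ℕ} (P : Set (Fin d → ℝ)) (r : ℕ) : PowerSeries ℤ :=
  PowerSeries.mk fun n =>
    if n = 0 then 1 else (latCount (frontier (((n : ℝ) / (r : ℝ)) • P)) : ℤ)

/-- `r` is the codenominator of `P`: given an irredundant halfspace description
`P = {x : A x ≤ b}` with integer data and `gcd(b_j, A_{j,1}, …, A_{j,d}) = 1` for each `j`,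
`r` is the least common multiple of the nonzero entries of `b`. -/
def IsCodenominator {d : ℕ} (P : Set (Fin d → ℝ)) (r : ℕ) : Prop :=
  ∃ (m : ℕ) (A : Fin m → Fin d → ℤ) (b : Fin m → ℤ),
    P = {x : Fin d → ℝ | ∀ j, (∑ i, (A j i : ℝ) * x i) ≤ (b j : ℝ)} ∧
    (∀ j₀ : Fin m,
      P ≠ {x : Fin d → ℝ | ∀ j, j ≠ j₀ → (∑ i, (A j i : ℝ) * x i) ≤ (b j : ℝ)}) ∧
    (∀ j, Int.gcd (b j) (Finset.univ.gcd fun i => A j i) = 1) ∧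
    (r : ℤ) = (Finset.univ.filter fun j => b j ≠ 0).lcm b

theorem hp_step {d : ℕ} (S : Set (Fin (d + 1) → ℝ)) (e : Fin (d + 1) → ℝ) (p : ℕ)
    (hfin : ∀ n : ℕ, {y ∈ S | IsLatticePt y ∧ y (Fin.last d) = (n : ℝ)}.Finite)
    (hpos : ∀ y ∈ S, 0 ≤ y (Fin.last d))
    (he : IsLatticePt e) (hep : e (Fin.last d) = (p : ℝ))
    (hadd : ∀ y ∈ S, y + e ∈ S) :
    (1 - PowerSeries.X ^ p) * sliceSeries S = sliceSeries {y ∈ S | y - e ∉ S} := by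
  have hsub : ∀ y, IsLatticePt y → IsLatticePt (y - e) := fun y hy i => by
    obtain ⟨a, ha⟩ := hy i
    obtain ⟨b, hb⟩ := he i
    exact ⟨a - b, by simp [ha, hb]⟩
  have hadd' : ∀ y, IsLatticePt y → IsLatticePt (y + e) := fun y hy i => by
    obtain ⟨a, ha⟩ := hy i
    obtain ⟨b, hb⟩ := he i
    exact ⟨a + b, by simp [ha, hb]⟩
  ext n
  rw [sub_mul, one_mul, map_sub, PowerSeries.coeff_X_pow_mul']
  simp only [sliceSeries, PowerSeries.coeff_mk]
  split_ifs with hpn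
  · have hu : {y ∈ S | IsLatticePt y ∧ y (Fin.last d) = (n : ℝ)} =
        {y ∈ {y ∈ S | y - e ∉ S} | IsLatticePt y ∧ y (Fin.last d) = (n : ℝ)} ∪
        (fun y => y + e) '' {y ∈ S | IsLatticePt y ∧ y (Fin.last d) = ((n - p : ℕ) : ℝ)} := by
      ext y
      simp only [Set.mem_ofPred_eq, Set.mem_union, Set.mem_image]
      constructor
      · rintro ⟨h1, h2, h3⟩
        by_cases h : y - e ∈ S
        · right
          refine ⟨y - e, ⟨h, hsub y h2, ?_⟩, by simp⟩
          simp [h3, hep, Nat.cast_sub hpn]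
        · left
          exact ⟨⟨h1, h⟩, h2, h3⟩
      · rintro (⟨⟨h1, _⟩, h2, h3⟩ | ⟨y', ⟨h1, h2, h3⟩, rfl⟩)
        · exact ⟨h1, h2, h3⟩
        · refine ⟨hadd _ h1, hadd' _ h2, ?_⟩
          simp [h3, hep, Nat.cast_sub hpn]
    rw [hu, Set.ncard_union_eq ?_ ?_ ((hfin _).image _), Set.ncard_image_of_injective _
      (add_left_injective e)]
    · push_cast
      ring
    · rw [Set.disjoint_left]
      rintro y ⟨⟨_, h⟩, _⟩ ⟨y', ⟨h1, _⟩, rfl⟩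
      exact h (by simpa using h1)
    · exact (hfin n).subset (fun y hy => ⟨hy.1.1, hy.2⟩)
  · rw [sub_zero]
    congr 2
    ext y
    simp only [Set.mem_ofPred_eq]
    constructor
    · rintro ⟨h1, h2, h3⟩
      refine ⟨⟨h1, fun h => ?_⟩, h2, h3⟩
      have := hpos _ h
      simp only [Pi.sub_apply, h3, hep] at this
      have h4 : (p : ℝ) ≤ n := by linarith
      exact hpn (by exact_mod_cast h4)
    · rintro ⟨⟨h1, _⟩, h2, h3⟩
      exact ⟨h1, h2, h3⟩

theorem hp_prod {d : ℕ} {ι : Type*} [DecidableEq ι] (B : Set (Fin (d + 1) → ℝ))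
    (e : ι → Fin (d + 1) → ℝ) (p : ℕ)
    (hfin : ∀ n : ℕ, {y ∈ B | IsLatticePt y ∧ y (Fin.last d) = (n : ℝ)}.Finite)
    (hpos : ∀ y ∈ B, 0 ≤ y (Fin.last d))
    (he : ∀ j, IsLatticePt (e j)) (hep : ∀ j, e j (Fin.last d) = (p : ℝ))
    (hadd : ∀ j, ∀ y ∈ B, y + e j ∈ B)
    (hcomm : ∀ i j, i ≠ j → ∀ y ∈ B, y + e i - e j ∈ B → y - e j ∈ B) (J : Finset ι) :
    (1 - PowerSeries.X ^ p) ^ J.card * sliceSeries B =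
      sliceSeries {y ∈ B | ∀ j ∈ J, y - e j ∉ B} := by
  induction J using Finset.induction_on with
  | empty => simp
  | insert i J hi ih =>
    rw [Finset.card_insert_of_notMem hi, pow_succ', mul_assoc, ih]
    rw [hp_step _ (e i) p ?_ ?_ (he i) (hep i) ?_]
    · congr 1
      ext y
      simp only [Set.mem_ofPred_eq, Finset.mem_insert, forall_eq_or_imp]
      constructor
      · rintro ⟨⟨h1, h2⟩, h3⟩
        refine ⟨h1, fun h => h3 ⟨h, fun j hj hj' => h2 j hj ?_⟩, h2⟩
        have := hadd i _ hj'
        rwa [show y - e i - e j + e i = y - e j by abel] at this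
      · rintro ⟨h1, h2, h3⟩
        exact ⟨⟨h1, h3⟩, fun h => h2 h.1⟩
    · intro n
      exact (hfin n).subset (fun y hy => ⟨hy.1.1, hy.2⟩)
    · intro y hy
      exact hpos y hy.1
    · rintro y ⟨h1, h2⟩
      refine ⟨hadd i y h1, fun j hj h => h2 j hj (hcomm i j ?_ y h1 h)⟩
      rintro rfl
      exact hi hj

theorem hp_linInd {d : ℕ} (w : Fin (d + 1) → (Fin d → ℝ)) (hind : AffineIndependent ℝ w) :
    LinearIndependent ℝ (fun j => (Fin.snoc (w j) 1 : Fin (d + 1) → ℝ)) := by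
  rw [Fintype.linearIndependent_iff]
  intro g hg i
  rw [affineIndependent_iff] at hind
  refine hind Finset.univ g ?_ ?_ i (Finset.mem_univ i)
  · have := congrFun hg (Fin.last d)
    simpa [Finset.sum_apply] using this
  · ext k
    have := congrFun hg (Fin.castSucc k)
    simpa [Finset.sum_apply] using this

theorem hp_coords {d : ℕ} (w : Fin (d + 1) → (Fin d → ℝ)) (hind : AffineIndependent ℝ w) :
    ∃ κ : (Fin (d + 1) → ℝ) →ₗ[ℝ] (Fin (d + 1) → ℝ),
      (∀ y, y = ∑ j, κ y j • (Fin.snoc (w j) 1 : Fin (d + 1) → ℝ)) ∧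
      (∀ c : Fin (d + 1) → ℝ, κ (∑ j, c j • (Fin.snoc (w j) 1 : Fin (d + 1) → ℝ)) = c) := by
  let b := basisOfLinearIndependentOfCardEqFinrank (hp_linInd w hind) (by simp)
  have hb : ∀ j, b j = (Fin.snoc (w j) 1 : Fin (d + 1) → ℝ) := fun j => by
    simp [b]
  refine ⟨b.equivFun.toLinearMap, fun y => ?_, fun c => ?_⟩
  · have := b.sum_equivFun y
    simp only [hb] at this
    exact this.symm
  · have := b.equivFun_symm_apply c
    simp only [hb] at this
    rw [← this]
    exact b.equivFun.apply_symm_apply c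

theorem hp_finite {d : ℕ} (w : Fin (d + 1) → (Fin d → ℝ)) (r n : ℕ) :
    {y ∈ homog w r | IsLatticePt y ∧ y (Fin.last d) = (n : ℝ)}.Finite := by
  obtain ⟨M, hM⟩ : ∃ M : ℕ, ∀ i, ∑ j, (n : ℝ) * |(Fin.snoc (w j) 1 : Fin (d + 1) → ℝ) i| ≤ M := by
    refine ⟨∑ i, ⌈∑ j, (n : ℝ) * |(Fin.snoc (w j) 1 : Fin (d + 1) → ℝ) i|⌉₊, fun i => ?_⟩
    refine (Nat.le_ceil _).trans ?_
    exact_mod_cast Finset.single_le_sum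
      (f := fun i => ⌈∑ j, (n : ℝ) * |(Fin.snoc (w j) 1 : Fin (d + 1) → ℝ) i|⌉₊)
      (fun _ _ => Nat.zero_le _) (Finset.mem_univ i)
  refine ((Set.finite_Icc (fun _ : Fin (d + 1) => -(M : ℤ)) (fun _ => (M : ℤ))).image
    (fun a i => (a i : ℝ))).subset ?_
  rintro y ⟨⟨c, hc1, hc2, hy⟩, hlat, hn⟩
  have hc : ∀ j, 0 ≤ c j := fun j => by
    rcases lt_or_ge (j : ℕ) r with h | h
    · exact (hc1 j h).le
    · exact hc2 j h
  have hsum : ∑ j, c j = n := by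
    rw [← hn, hy]
    simp [Finset.sum_apply]
  have hcn : ∀ j, c j ≤ n := fun j => by
    rw [← hsum]
    exact Finset.single_le_sum (fun i _ => hc i) (Finset.mem_univ j)
  choose a ha using hlat
  have hb : ∀ i, |y i| ≤ M := fun i => by
    refine le_trans ?_ (hM i)
    rw [hy, Finset.sum_apply]
    refine (Finset.abs_sum_le_sum_abs _ _).trans (Finset.sum_le_sum fun j _ => ?_)
    rw [Pi.smul_apply, smul_eq_mul, abs_mul, abs_of_nonneg (hc j)]
    exact mul_le_mul_of_nonneg_right (hcn j) (abs_nonneg _)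
  refine ⟨a, ⟨fun i => ?_, fun i => ?_⟩, funext fun i => (ha i).symm⟩
  · have := (abs_le.1 (hb i)).1
    rw [ha i] at this
    exact_mod_cast this
  · have := (abs_le.1 (hb i)).2
    rw [ha i] at this
    exact_mod_cast this

theorem hp_interior {d n : ℕ} (P : Set (Fin d → ℝ)) (hP : Convex ℝ P)
    (x : Fin d → ℝ) (hx : x ∈ interior P) (v : Fin d → (Fin d → ℝ))
    (hvbd : convexHull ℝ (Set.range v) ⊆ frontier P)
    (c : Fin d → ℝ) (t : ℝ) (hc : ∀ j, 0 ≤ c j) (ht : 0 < t) (hs : ∑ j, c j + t = n) :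
    0 < n ∧ ∑ j, c j • v j + t • x ∈ interior ((n : ℝ) • P) := by
  have hs0 : 0 ≤ ∑ j, c j := Finset.sum_nonneg fun j _ => hc j
  have hn : (0 : ℝ) < n := by linarith
  refine ⟨by exact_mod_cast hn, ?_⟩
  rw [interior_smul₀ hn.ne']
  rcases hs0.eq_or_lt with h | h
  · have h0 : ∀ j, c j = 0 := fun j =>
      (Finset.sum_eq_zero_iff_of_nonneg (fun j _ => hc j)).1 h.symm j (Finset.mem_univ j)
    rw [← h, zero_add] at hs
    refine ⟨x, hx, ?_⟩
    simp [h0, hs]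
  · set s := ∑ j, c j with hsdef
    have hy0 : ∑ j, (c j / s) • v j ∈ convexHull ℝ (Set.range v) := by
      refine (convex_convexHull ℝ _).sum_mem (fun j _ => div_nonneg (hc j) hs0) ?_
        (fun j _ => subset_convexHull ℝ _ ⟨j, rfl⟩)
      rw [← Finset.sum_div, ← hsdef, div_self h.ne']
    have hy1 := frontier_subset_closure (hvbd hy0)
    have := hP.combo_closure_interior_mem_interior hy1 hx (a := s / n) (b := t / n)
      (by positivity) (by positivity) (by rw [← add_div, hs, div_self hn.ne'])
    refine ⟨_, this, ?_⟩
    simp only [smul_add, Finset.smul_sum, smul_smul]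
    congr 1
    · refine Finset.sum_congr rfl fun j _ => ?_
      congr 1
      field_simp
    · congr 1
      field_simp

/-- **Statement 9.** (Half-open pyramid lemma.) Let `P ⊆ ℝ^d` be full-dimensional rational
with denominator `q`, `l` minimal with `(lP)°` containing a lattice point, `x ∈ P°` with
`l x ∈ ℤ^d`.  Let `Δ ⊆ ∂P` be a half-open `(d−1)`-simplex with vertices
`v 0, …, v (d-1) ∈ (1/q)ℤ^d` and the facets opposite the first `r` vertices removed, and
let `Pyr(x,Δ)` be the half-open `d`-simplex on `v 0, …, v (d-1), x` with the same facets
removed.  With `h*_Δ(z) = (1−z^q)^d ∑_{m ∈ hom(Δ) ∩ ℤ^{d+1}} z^{m_{d+1}}` and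
`h*_{Pyr(x,Δ)}(z) = (1−z^q)^d (1−z^l) ∑_{m ∈ hom(Pyr(x,Δ)) ∩ ℤ^{d+1}} z^{m_{d+1}}`,
we have `h*_{Pyr(x,Δ)}(z) = h*_Δ(z) + z^l b_Δ(z)` for a polynomial `b_Δ` with nonnegative
integer coefficients. -/
theorem halfopen_pyramid_hstar {d q l r : ℕ} (P : Set (Fin d → ℝ))
    (hrat : IsRationalPolytope P) (hfull : IsFullDim P)
    (hq : IsDenominator P q) (hl : IsMinInteriorDilate P l)
    (x : Fin d → ℝ) (hx : x ∈ interior P) (hlx : IsLatticePt ((l : ℝ) • x))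
    (v : Fin d → (Fin d → ℝ)) (hr : r ≤ d)
    (hv : ∀ j i, ∃ a : ℤ, (q : ℝ) * v j i = (a : ℝ))
    (hvbd : convexHull ℝ (Set.range v) ⊆ frontier P)
    (hind : AffineIndependent ℝ (Fin.snoc v x : Fin (d + 1) → (Fin d → ℝ)))
    (hΔ hPyr : Polynomial ℤ)
    (hΔeq : (hΔ : PowerSeries ℤ) =
      (1 - PowerSeries.X ^ q) ^ d * sliceSeries (homog v r))
    (hPyreq : (hPyr : PowerSeries ℤ) =
      (1 - PowerSeries.X ^ q) ^ d * (1 - PowerSeries.X ^ l) *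
        sliceSeries (homog (Fin.snoc v x : Fin (d + 1) → (Fin d → ℝ)) r)) :
    ∃ b : Polynomial ℤ, (∀ i, 0 ≤ b.coeff i) ∧ hPyr = hΔ + Polynomial.X ^ l * b := by
  have hP : Convex ℝ P := by
    obtain ⟨V, _, rfl⟩ := hrat
    exact convex_convexHull ℝ _
  obtain ⟨hl0, -, hlmin⟩ := hl
  obtain ⟨κ, hκ1, hκ2⟩ := hp_coords _ hind
  set w : Fin (d + 1) → (Fin d → ℝ) := Fin.snoc v x with hw
  have hwc : ∀ j : Fin d, w j.castSucc = v j := fun j => by simp [hw]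
  have hwl : w (Fin.last d) = x := by simp [hw]
  -- coordinates of the generators
  have hκu : ∀ (a : ℝ) (j : Fin (d + 1)),
      κ (a • (Fin.snoc (w j) 1 : Fin (d + 1) → ℝ)) = Pi.single j a := fun a j => by
    rw [← hκ2 (Pi.single j a)]
    congr 1
    rw [Finset.sum_eq_single j]
    · simp
    · intro i _ hij
      simp [Pi.single_eq_of_ne hij]
    · simp
  have hlast : ∀ y : Fin (d + 1) → ℝ, y (Fin.last d) = ∑ j, κ y j := fun y => by
    conv_lhs => rw [hκ1 y]
    simp [Finset.sum_apply]
  -- descriptions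
  have hH : ∀ y, y ∈ homog w r ↔ (∀ j : Fin (d + 1), (j : ℕ) < r → 0 < κ y j) ∧
      (∀ j : Fin (d + 1), r ≤ (j : ℕ) → 0 ≤ κ y j) := fun y => by
    constructor
    · rintro ⟨c, h1, h2, rfl⟩
      rw [hκ2]
      exact ⟨h1, h2⟩
    · rintro ⟨h1, h2⟩
      exact ⟨κ y, h1, h2, hκ1 y⟩
  have hHv : ∀ y, y ∈ homog v r ↔ y ∈ homog w r ∧ κ y (Fin.last d) = 0 := fun y => by
    constructor
    · rintro ⟨c, h1, h2, hy⟩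
      have hy' : y = ∑ j, (Fin.snoc c 0 : Fin (d + 1) → ℝ) j •
          (Fin.snoc (w j) 1 : Fin (d + 1) → ℝ) := by
        rw [Fin.sum_univ_castSucc, hy]
        simp [hwc]
      refine ⟨⟨Fin.snoc c 0, fun j => ?_, fun j => ?_, hy'⟩, ?_⟩
      · refine Fin.lastCases ?_ (fun j => ?_) j
        · intro h
          simp at h
          omega
        · intro h
          simpa using h1 j (by simpa using h)
      · refine Fin.lastCases ?_ (fun j => ?_) j
        · intro h
          simp
        · intro h
          simpa using h2 j (by simpa using h)
      · rw [hy', hκ2]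
        simp
    · rintro ⟨h, h0⟩
      rw [hH] at h
      refine ⟨fun j => κ y j.castSucc, fun j hj => h.1 _ (by simpa using hj),
        fun j hj => h.2 _ (by simpa using hj), ?_⟩
      conv_lhs => rw [hκ1 y]
      rw [Fin.sum_univ_castSucc, h0]
      simp [hwc]
  have hnn : ∀ y ∈ homog w r, ∀ j, 0 ≤ κ y j := fun y hy j => by
    rw [hH] at hy
    rcases lt_or_ge (j : ℕ) r with h | h
    · exact (hy.1 j h).le
    · exact hy.2 j h
  have hpos : ∀ y ∈ homog w r, 0 ≤ y (Fin.last d) := fun y hy => by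
    rw [hlast y]
    exact Finset.sum_nonneg fun j _ => hnn y hy j
  have hHadd : ∀ (a : ℝ) (j : Fin (d + 1)), 0 ≤ a → ∀ y ∈ homog w r,
      y + a • (Fin.snoc (w j) 1 : Fin (d + 1) → ℝ) ∈ homog w r := fun a j ha y hy => by
    have hs : ∀ i, 0 ≤ (Pi.single j a : Fin (d + 1) → ℝ) i := fun i => by
      by_cases h : i = j
      · subst h
        simpa using ha
      · simp [Pi.single_eq_of_ne h]
    rw [hH] at hy ⊢
    rw [map_add, hκu]
    exact ⟨fun i hi => add_pos_of_pos_of_nonneg (hy.1 i hi) (hs i),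
      fun i hi => add_nonneg (hy.2 i hi) (hs i)⟩
  have hl0' : (0 : ℝ) < l := by exact_mod_cast hl0
  have hfin := hp_finite w r
  set el : Fin (d + 1) → ℝ := (l : ℝ) • (Fin.snoc (w (Fin.last d)) 1 : Fin (d + 1) → ℝ) with hel
  set D : Set (Fin (d + 1) → ℝ) := {y ∈ homog w r | y - el ∉ homog w r} with hD
  set E : Set (Fin (d + 1) → ℝ) :=
    {y ∈ homog w r | 0 < κ y (Fin.last d) ∧ κ y (Fin.last d) < l} with hE
  have hDm : ∀ y, y ∈ D ↔ y ∈ homog w r ∧ κ y (Fin.last d) < l := fun y => by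
    simp only [hD, Set.mem_ofPred_eq]
    refine and_congr_right fun hy => ?_
    rw [← not_le, not_iff_not]
    constructor
    · intro h
      have := hnn _ h (Fin.last d)
      rw [map_sub, hel, hκu] at this
      simpa using this
    · intro h
      rw [hH] at hy ⊢
      rw [map_sub, hel, hκu]
      refine ⟨fun i hi => ?_, fun i hi => ?_⟩
      · have hne : i ≠ Fin.last d := by
          rintro rfl
          simp at hi
          omega
        simpa [Pi.single_eq_of_ne hne] using hy.1 i hi
      · by_cases hne : i = Fin.last d
        · subst hne
          simpa using h
        · simpa [Pi.single_eq_of_ne hne] using hy.2 i hi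
  have h1 : (1 - PowerSeries.X ^ l) * sliceSeries (homog w r) = sliceSeries D := by
    refine hp_step _ el l hfin hpos ?_ ?_ (hHadd _ _ hl0'.le)
    · intro i
      refine Fin.lastCases ?_ (fun i => ?_) i
      · exact ⟨l, by simp [hel]⟩
      · obtain ⟨a, ha⟩ := hlx i
        exact ⟨a, by simpa [hel, hwl] using ha⟩
    · simp [hel]
  have h2 : sliceSeries D = sliceSeries (homog v r) + sliceSeries E := by
    ext n
    simp only [sliceSeries, map_add, PowerSeries.coeff_mk]
    rw [← Nat.cast_add, ← Set.ncard_union_eq ?_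
      ((hfin n).subset fun y hy => ⟨((hHv y).1 hy.1).1, hy.2⟩)
      ((hfin n).subset fun y hy => ⟨hy.1.1, hy.2⟩)]
    · congr 2
      ext y
      simp only [Set.mem_ofPred_eq, Set.mem_union, hDm, hHv, hE]
      constructor
      · rintro ⟨⟨a, b⟩, c⟩
        rcases (hnn y a (Fin.last d)).eq_or_lt with h | h
        · exact Or.inl ⟨⟨a, h.symm⟩, c⟩
        · exact Or.inr ⟨⟨a, h, b⟩, c⟩
      · rintro (⟨⟨a, b⟩, c⟩ | ⟨⟨a, b, b'⟩, c⟩)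
        · exact ⟨⟨a, by rw [b]; exact hl0'⟩, c⟩
        · exact ⟨⟨a, b'⟩, c⟩
    · rw [Set.disjoint_left]
      rintro y ⟨ha, _⟩ ⟨hb, _⟩
      rw [hHv] at ha
      exact hb.2.1.ne' ha.2
  set e : Fin d → Fin (d + 1) → ℝ :=
    fun j => (q : ℝ) • (Fin.snoc (w j.castSucc) 1 : Fin (d + 1) → ℝ) with he
  have hκe : ∀ j, κ (e j) = Pi.single j.castSucc (q : ℝ) := fun j => hκu _ _
  have hne : ∀ j : Fin d, Fin.last d ≠ j.castSucc := fun j => (Fin.castSucc_lt_last j).ne'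
  have h3 : (1 - PowerSeries.X ^ q) ^ d * sliceSeries E =
      sliceSeries {y ∈ E | ∀ j ∈ (Finset.univ : Finset (Fin d)), y - e j ∉ E} := by
    have := hp_prod E e q (fun n => (hfin n).subset fun y hy => ⟨hy.1.1, hy.2⟩)
      (fun y hy => hpos y hy.1) ?_ ?_ ?_ ?_ Finset.univ
    · simpa using this
    · intro j i
      refine Fin.lastCases ?_ (fun i => ?_) i
      · exact ⟨q, by simp [he]⟩
      · obtain ⟨a, ha⟩ := hv j i
        exact ⟨a, by simpa [he, hwc] using ha⟩
    · intro j
      simp [he]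
    · rintro j y ⟨ha, hb⟩
      refine ⟨hHadd _ _ (Nat.cast_nonneg q) y ha, ?_⟩
      rw [map_add, hκe]
      simpa [Pi.single_eq_of_ne (hne j)] using hb
    · rintro i j hij y ⟨ha, hb⟩ ⟨ha', hb'⟩
      refine ⟨?_, ?_⟩
      · rw [hH] at ha ha' ⊢
        rw [map_sub, map_add, hκe, hκe] at ha'
        rw [map_sub, hκe]
        have hij' : j.castSucc ≠ i.castSucc := fun h => hij (Fin.castSucc_injective _ h).symm
        refine ⟨fun k hk => ?_, fun k hk => ?_⟩
        · by_cases hkj : k = j.castSucc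
          · subst hkj
            simpa [Pi.single_eq_of_ne hij'] using ha'.1 _ hk
          · simpa [Pi.single_eq_of_ne hkj] using ha.1 k hk
        · by_cases hkj : k = j.castSucc
          · subst hkj
            simpa [Pi.single_eq_of_ne hij'] using ha'.2 _ hk
          · simpa [Pi.single_eq_of_ne hkj] using ha.2 k hk
      · rw [map_sub, hκe]
        simpa [Pi.single_eq_of_ne (hne j)] using hb
  have hdiff : ((hPyr - hΔ : Polynomial ℤ) : PowerSeries ℤ) =
      sliceSeries {y ∈ E | ∀ j ∈ (Finset.univ : Finset (Fin d)), y - e j ∉ E} := by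
    rw [← h3, Polynomial.coe_sub, hPyreq, hΔeq, mul_assoc, h1, h2]
    ring
  have hcoeff : ∀ n, (hPyr - hΔ).coeff n = ((Set.ncard {y ∈ {y ∈ E | ∀ j ∈ (Finset.univ :
      Finset (Fin d)), y - e j ∉ E} | IsLatticePt y ∧ y (Fin.last d) = (n : ℝ)} : ℕ) : ℤ) := by
    intro n
    rw [← Polynomial.coeff_coe, hdiff, sliceSeries, PowerSeries.coeff_mk]
  have hlow : ∀ n < l, (hPyr - hΔ).coeff n = 0 := by
    intro n hn
    rw [hcoeff, Nat.cast_eq_zero]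
    convert Set.ncard_empty (Fin (d + 1) → ℝ)
    rw [Set.eq_empty_iff_forall_notMem]
    rintro y ⟨⟨⟨hy, hy0, _⟩, _⟩, hlat, hyn⟩
    have hsum : ∑ j : Fin d, κ y j.castSucc + κ y (Fin.last d) = n := by
      rw [← hyn, hlast y, Fin.sum_univ_castSucc]
    obtain ⟨hn0, hmem⟩ := hp_interior P hP x hx v hvbd (fun j => κ y j.castSucc) _
      (fun j => hnn y hy _) hy0 hsum
    refine absurd (hlmin n hn0 ⟨_, fun i => ?_, hmem⟩) (not_le.2 hn)
    obtain ⟨a, ha⟩ := hlat i.castSucc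
    refine ⟨a, ?_⟩
    rw [← ha]
    conv_rhs => rw [hκ1 y]
    rw [Fin.sum_univ_castSucc]
    simp [Finset.sum_apply, hwc, hwl]
  obtain ⟨b, hb⟩ := Polynomial.X_pow_dvd_iff.2 hlow
  refine ⟨b, fun i => ?_, by rw [← hb]; ring⟩
  have : b.coeff i = (hPyr - hΔ).coeff (i + l) := by
    rw [hb, Polynomial.coeff_X_pow_mul]
  rw [this, hcoeff]
  exact Int.natCast_nonneg _
end

section
/- Let P ⊂ ℝ^{d−1} be a full-dimensional rational polytope with denominator q, regarded as a subset of ℝ^d via the embedding appending a last coordinate 0, and let Pyr(e_d, P) := conv(P ∪ {e_d}) ⊂ ℝ^d be the pyramid over P with apex the standard basis vector e_d. Then (1−z^q)^d·Ehr_P(z) and (1−z^q)^d(1−z)·Ehr_{Pyr(e_d,P)}(z) are polynomials and they are equal. -/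
open Pointwise

open PowerSeries in
/-- eventually zero coefficients -/
def EvZ (A : PowerSeries ℤ) : Prop := ∃ N, ∀ n ≥ N, coeff n A = 0

lemma EvZ.poly {A : PowerSeries ℤ} (h : EvZ A) : ∃ p : Polynomial ℤ, (p : PowerSeries ℤ) = A := by
  obtain ⟨N, hN⟩ := h
  refine ⟨PowerSeries.trunc N A, ?_⟩
  ext n
  rw [Polynomial.coeff_coe, PowerSeries.coeff_trunc]
  split_ifs with h
  · rfl
  · exact (hN n (by omega)).symm

lemma EvZ.add {A B : PowerSeries ℤ} (hA : EvZ A) (hB : EvZ B) : EvZ (A + B) := by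
  obtain ⟨N, hN⟩ := hA
  obtain ⟨M, hM⟩ := hB
  refine ⟨N + M, fun n hn => ?_⟩
  rw [map_add, hN n (by omega), hM n (by omega), add_zero]

lemma EvZ.sub {A B : PowerSeries ℤ} (hA : EvZ A) (hB : EvZ B) : EvZ (A - B) := by
  obtain ⟨N, hN⟩ := hA
  obtain ⟨M, hM⟩ := hB
  refine ⟨N + M, fun n hn => ?_⟩
  rw [map_sub, hN n (by omega), hM n (by omega), sub_zero]

lemma EvZ.zero : EvZ 0 := ⟨0, fun n _ => by simp⟩

lemma EvZ.Xpow {A : PowerSeries ℤ} (hA : EvZ A) (e : ℕ) : EvZ (PowerSeries.X ^ e * A) := by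
  obtain ⟨N, hN⟩ := hA
  refine ⟨N + e, fun n hn => ?_⟩
  rw [PowerSeries.coeff_X_pow_mul']
  split_ifs with h
  · exact hN _ (by omega)
  · rfl

lemma coeff_diff (q j : ℕ) (A : PowerSeries ℤ) (n : ℕ) :
    PowerSeries.coeff (n + j * q) ((1 - PowerSeries.X ^ q) ^ j * A) =
      (fwdDiff q)^[j] (fun n => PowerSeries.coeff n A) n := by
  induction j generalizing n with
  | zero => simp
  | succ j ih =>
    rw [Function.iterate_succ_apply', fwdDiff, ← ih, ← ih, pow_succ', mul_assoc, sub_mul, one_mul,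
      map_sub]
    have : n + (j + 1) * q = (n + j * q) + q := by ring
    rw [this, PowerSeries.coeff_X_pow_mul]
    congr 2
    congr 1
    ring

open Filter Asymptotics Topology in
lemma choose_growth (d : ℕ) (x : ℕ → ℝ) (C : ℝ) (m : ℕ)
    (hb : ∀ n : ℕ, |∑ k ∈ Finset.range m, (n.choose k : ℝ) * x k| ≤ C * (n + 1 : ℝ) ^ d) :
    ∀ k, d < k → k < m → x k = 0 := by
  induction m with
  | zero => intro k _ h; omega
  | succ m ih =>
    by_cases hm : d < m
    · have hx : x m = 0 := by
        have ho : ∀ k, k < m → (fun n : ℕ => (n.choose k : ℝ) * x k) =o[atTop] (fun n : ℕ => (n : ℝ) ^ m) := by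
          intro k hk
          have h1 : (fun n : ℕ => (n.choose k : ℝ)) =O[atTop] (fun n : ℕ => (n : ℝ) ^ k) :=
            (isTheta_choose k).1
          have h2 : (fun n : ℕ => (n : ℝ) ^ k) =o[atTop] (fun n : ℕ => (n : ℝ) ^ m) :=
            (isLittleO_pow_pow_atTop_of_lt hk).comp_tendsto tendsto_natCast_atTop_atTop
          have h3 := (h1.trans_isLittleO h2).const_mul_left (x k)
          simpa [mul_comm] using h3
        have hs : (fun n : ℕ => ∑ k ∈ Finset.range m, (n.choose k : ℝ) * x k) =o[atTop]
            (fun n : ℕ => (n : ℝ) ^ m) :=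
          IsLittleO.fun_sum (fun k hk => ho k (Finset.mem_range.1 hk))
        have ht : (fun n : ℕ => ∑ k ∈ Finset.range (m+1), (n.choose k : ℝ) * x k) =o[atTop]
            (fun n : ℕ => (n : ℝ) ^ m) := by
          have h1 : (fun n : ℕ => ∑ k ∈ Finset.range (m+1), (n.choose k : ℝ) * x k) =O[atTop]
              (fun n : ℕ => (n : ℝ) ^ d) := by
            refine IsBigO.of_bound (C * 2 ^ d) ?_
            filter_upwards [eventually_ge_atTop 1] with n hn
            have hn' : (1 : ℝ) ≤ n := by exact_mod_cast hn
            have hC : 0 ≤ C := by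
              have := (abs_nonneg _).trans (hb 0)
              simpa using this
            rw [Real.norm_eq_abs, Real.norm_of_nonneg (by positivity)]
            refine (hb n).trans ?_
            rw [mul_assoc, ← mul_pow]
            gcongr
            linarith
          exact h1.trans_isLittleO
            ((isLittleO_pow_pow_atTop_of_lt hm).comp_tendsto tendsto_natCast_atTop_atTop)
        have hu : (fun n : ℕ => (n.choose m : ℝ) * x m) =o[atTop] (fun n : ℕ => (n : ℝ) ^ m) := by
          refine (ht.sub hs).congr_left ?_
          intro n
          rw [Finset.sum_range_succ]; ring
        have hv : (fun n : ℕ => (n : ℝ) ^ m) =O[atTop] (fun n : ℕ => (n.choose m : ℝ)) :=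
          (isTheta_choose m).2
        by_contra hne
        have hw : (fun n : ℕ => (n.choose m : ℝ)) =o[atTop] (fun n : ℕ => (n.choose m : ℝ)) := by
          refine (((hu.const_mul_left (x m)⁻¹).congr_left ?_).trans_isBigO hv)
          intro n
          field_simp
        have := hw.eventuallyLE
        have h5 := isLittleO_irrefl (f'' := (fun n : ℕ => (n.choose m : ℝ))) (l := atTop) (by
          refine Eventually.frequently ?_
          filter_upwards [eventually_ge_atTop m] with n hn
          have := Nat.choose_pos hn
          positivity)
        exact h5 hw
      intro k hk hk'
      rcases Nat.lt_succ_iff_lt_or_eq.1 hk' with h | h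
      · refine ih (fun n => ?_) k hk h
        have := hb n
        rwa [Finset.sum_range_succ, hx, mul_zero, add_zero] at this
      · rw [h, hx]
    · intro k hk hk'; omega

lemma EvZ.growth {q d m : ℕ} {A : PowerSeries ℤ} (h : EvZ ((1 - PowerSeries.X ^ q) ^ m * A))
    (C : ℕ) (hC : ∀ n, |PowerSeries.coeff n A| ≤ (C : ℤ) * ((n : ℤ) + 1) ^ d) :
    EvZ ((1 - PowerSeries.X ^ q) ^ (d + 1) * A) := by
  obtain ⟨N, hN⟩ := h
  set a : ℕ → ℤ := fun n => PowerSeries.coeff n A with ha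
  have h0 : ∀ y ≥ N, (fwdDiff q)^[m] a y = 0 := fun y hy => by
    rw [← coeff_diff]; exact hN _ (by nlinarith [Nat.zero_le (m * q)])
  have h1 : ∀ j, ∀ y ≥ N, (fwdDiff q)^[m + j] a y = 0 := by
    intro j
    induction j with
    | zero => exact h0
    | succ j ih =>
      intro y hy
      rw [← add_assoc, Function.iterate_succ_apply', fwdDiff, ih y hy, ih (y + q) (by omega), sub_zero]
  refine ⟨N + (d + 1) * q, fun n hn => ?_⟩
  obtain ⟨y, rfl⟩ : ∃ y, n = y + (d + 1) * q := ⟨n - (d + 1) * q, by omega⟩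
  rw [coeff_diff]
  have hy : N ≤ y := by omega
  rcases le_or_gt m (d + 1) with hm | hm
  · obtain ⟨j, hj⟩ := Nat.exists_eq_add_of_le hm
    rw [hj]; exact h1 j y hy
  · have := choose_growth d (fun k => (((fwdDiff q)^[k] a y : ℤ) : ℝ)) (C * (y + q + 1) ^ d) m ?_ (d + 1)
      (by omega) hm
    · exact_mod_cast this
    · intro n
      have h2 := shift_eq_sum_fwdDiff_iter q a n y
      have h3 : ∑ k ∈ Finset.range (n + 1), n.choose k • (fwdDiff q)^[k] a y =
          ∑ k ∈ Finset.range m, n.choose k • (fwdDiff q)^[k] a y := by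
        have e1 : ∑ k ∈ Finset.range (n + 1), n.choose k • (fwdDiff q)^[k] a y =
          ∑ k ∈ Finset.range (n + 1 + m), n.choose k • (fwdDiff q)^[k] a y := by
          apply Finset.sum_subset
          · intro k hk; simp at *; omega
          · intro k _ hk
            rw [Nat.choose_eq_zero_of_lt (by simpa using hk), zero_smul]
        have e2 : ∑ k ∈ Finset.range m, n.choose k • (fwdDiff q)^[k] a y =
          ∑ k ∈ Finset.range (n + 1 + m), n.choose k • (fwdDiff q)^[k] a y := by
          apply Finset.sum_subset
          · intro k hk; simp at *; omega
          · intro k _ hk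
            obtain ⟨j, hj⟩ := Nat.exists_eq_add_of_le (show m ≤ k by simpa using hk)
            rw [hj, h1 j y hy, smul_zero]
        rw [e1, e2]
      rw [h3] at h2
      have h4 : (∑ k ∈ Finset.range m, (n.choose k : ℝ) * (((fwdDiff q)^[k] a y : ℤ) : ℝ)) =
          ((a (y + n • q) : ℤ) : ℝ) := by
        rw [h2]; push_cast; simp
      rw [h4]
      have h5 : |((a (y + n • q) : ℤ) : ℝ)| ≤ C * (((y + n • q : ℕ) : ℝ) + 1) ^ d := by
        exact_mod_cast hC (y + n • q)
      refine h5.trans ?_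
      rw [mul_assoc, ← mul_pow]
      gcongr
      push_cast [smul_eq_mul]
      have : (0:ℝ) ≤ y * n := by positivity
      have : (0:ℝ) ≤ n := by positivity
      have : (0:ℝ) ≤ q := by positivity
      nlinarith

noncomputable def cnt {m : ℕ} (q e : ℕ) (S : Set (Fin m → ℕ)) : PowerSeries ℤ :=
  PowerSeries.mk fun n => (Set.ncard {a ∈ S | e + q * ∑ i, a i = n} : ℤ)

lemma cnt_fin {m q : ℕ} (hq : 0 < q) (e n : ℕ) (S : Set (Fin m → ℕ)) :
    {a ∈ S | e + q * ∑ i, a i = n}.Finite := by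
  refine (Set.finite_Iic (fun _ : Fin m => n)).subset ?_
  rintro a ⟨_, ha⟩ i
  have h1 : a i ≤ ∑ i, a i := Finset.single_le_sum (f := a) (fun _ _ => Nat.zero_le _) (Finset.mem_univ i)
  show a i ≤ n
  nlinarith

lemma cnt_union {m q : ℕ} (hq : 0 < q) (e : ℕ) (S T : Set (Fin m → ℕ)) :
    cnt q e (S ∪ T) = cnt q e S + cnt q e T - cnt q e (S ∩ T) := by
  ext n
  simp only [cnt, PowerSeries.coeff_mk, map_add, map_sub]
  have h := Set.ncard_union_add_ncard_inter {a ∈ S | e + q * ∑ i, a i = n}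
    {a ∈ T | e + q * ∑ i, a i = n} (cnt_fin hq e n S) (cnt_fin hq e n T)
  have h1 : {a ∈ S | e + q * ∑ i, a i = n} ∪ {a ∈ T | e + q * ∑ i, a i = n} =
      {a ∈ S ∪ T | e + q * ∑ i, a i = n} := by
    ext a; simp only [Set.mem_union, Set.mem_ofPred_eq]; tauto
  have h2 : {a ∈ S | e + q * ∑ i, a i = n} ∩ {a ∈ T | e + q * ∑ i, a i = n} =
      {a ∈ S ∩ T | e + q * ∑ i, a i = n} := by
    ext a; simp only [Set.mem_inter_iff, Set.mem_ofPred_eq]; tauto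
  rw [h1, h2] at h
  omega

lemma cnt_empty {m q e : ℕ} : cnt q e (∅ : Set (Fin m → ℕ)) = 0 := by
  ext n
  simp [cnt]

lemma cnt_shift {m q : ℕ} (e : ℕ) (S : Set (Fin m → ℕ)) :
    cnt q e S = PowerSeries.X ^ e * cnt q 0 S := by
  ext n
  rw [PowerSeries.coeff_X_pow_mul']
  simp only [cnt, PowerSeries.coeff_mk]
  split_ifs with h
  · congr 2
    ext a
    simp only [Set.mem_ofPred_eq]
    refine and_congr_right fun _ => ?_
    omega
  · have : {a ∈ S | e + q * ∑ i, a i = n} = ∅ := by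
      ext a
      simp only [Set.mem_ofPred_eq, Set.mem_empty_iff_false, iff_false, not_and]
      intro _ _; omega
    rw [this]; simp

lemma cnt_image {m q : ℕ} (e : ℕ) (S : Set (Fin m → ℕ)) (b : Fin m → ℕ) :
    cnt q e ((fun a => b + a) '' S) = cnt q (e + q * ∑ i, b i) S := by
  ext n
  simp only [cnt, PowerSeries.coeff_mk]
  congr 1
  rw [← Set.ncard_image_of_injective {a ∈ S | e + q * ∑ i, b i + q * ∑ i, a i = n}
    (add_right_injective b)]
  congr 1
  ext a
  simp only [Set.mem_ofPred_eq, Set.mem_image]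
  constructor
  · rintro ⟨⟨c, hc, rfl⟩, h⟩
    refine ⟨c, ⟨hc, ?_⟩, rfl⟩
    rw [← h]; simp [Finset.sum_add_distrib]; ring
  · rintro ⟨c, ⟨hc, h⟩, rfl⟩
    refine ⟨⟨c, hc, rfl⟩, ?_⟩
    rw [← h]; simp [Finset.sum_add_distrib]; ring

lemma cnt_univ {m q : ℕ} (hq : 0 < q) :
    (1 - PowerSeries.X ^ q) ^ m * cnt q 0 (Set.univ : Set (Fin m → ℕ)) = 1 := by
  induction m with
  | zero =>
    ext n
    simp only [cnt, pow_zero, one_mul, PowerSeries.coeff_mk, PowerSeries.coeff_one]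
    split_ifs with h
    · simp [h]
    · have : {a ∈ (Set.univ : Set (Fin 0 → ℕ)) | 0 + q * ∑ i, a i = n} = ∅ := by
        ext a; simp; omega
      rw [this]; simp
  | succ m ih =>
    have hA : cnt q 0 {a : Fin (m+1) → ℕ | a 0 = 0} = cnt q 0 (Set.univ : Set (Fin m → ℕ)) := by
      ext n
      simp only [cnt, PowerSeries.coeff_mk]
      congr 1
      rw [← Set.ncard_image_of_injective {a ∈ (Set.univ : Set (Fin m → ℕ)) | 0 + q * ∑ i, a i = n}
        (Fin.cons_right_injective (α := fun _ => ℕ) 0)]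
      congr 1
      ext a
      simp only [Set.mem_ofPred_eq, Set.mem_image, Set.mem_univ, true_and]
      constructor
      · rintro ⟨h0, h⟩
        refine ⟨Fin.tail a, ?_, ?_⟩
        · rw [← h, Fin.sum_univ_succ, h0]; simp [Fin.tail]
        · rw [← h0]; exact Fin.cons_self_tail a
      · rintro ⟨c, h, rfl⟩
        refine ⟨rfl, ?_⟩
        rw [← h, Fin.sum_univ_succ]; simp
    have hB : cnt q 0 {a : Fin (m+1) → ℕ | a 0 ≠ 0} =
        PowerSeries.X ^ q * cnt q 0 (Set.univ : Set (Fin (m+1) → ℕ)) := by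
      rw [← cnt_shift]
      have : {a : Fin (m+1) → ℕ | a 0 ≠ 0} = (fun a => (Pi.single 0 1 : Fin (m+1) → ℕ) + a) '' Set.univ := by
        ext a
        simp only [Set.mem_ofPred_eq, Set.image_univ, Set.mem_range]
        constructor
        · intro h
          refine ⟨a - Pi.single 0 1, add_tsub_cancel_of_le ?_⟩
          intro i
          by_cases hi : i = 0
          · subst hi; simp; omega
          · simp [hi]
        · rintro ⟨y, rfl⟩
          simp
      rw [this, cnt_image]
      simp
    have hU : (Set.univ : Set (Fin (m+1) → ℕ)) = {a | a 0 = 0} ∪ {a | a 0 ≠ 0} := by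
      ext a; simp; tauto
    have hI : ({a | a 0 = 0} ∩ {a | a 0 ≠ 0} : Set (Fin (m+1) → ℕ)) = ∅ := by
      ext a; simp
    have h := cnt_union hq 0 {a : Fin (m+1) → ℕ | a 0 = 0} {a | a 0 ≠ 0}
    rw [← hU, hI, cnt_empty, hA, hB] at h
    rw [pow_succ]
    linear_combination (1 - PowerSeries.X ^ q) ^ m * h + ih

lemma cnt_univ_evz {m q : ℕ} (hq : 0 < q) (e : ℕ) :
    EvZ ((1 - PowerSeries.X ^ q) ^ m * cnt q e (Set.univ : Set (Fin m → ℕ))) := by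
  rw [cnt_shift, mul_left_comm, cnt_univ hq]
  refine EvZ.Xpow ⟨1, fun n hn => ?_⟩ e
  rw [PowerSeries.coeff_one, if_neg (by omega)]

lemma cnt_Ici_evz {m q : ℕ} (hq : 0 < q) (e : ℕ) (b : Fin m → ℕ) :
    EvZ ((1 - PowerSeries.X ^ q) ^ m * cnt q e (Set.Ici b)) := by
  have : Set.Ici b = (fun a => b + a) '' Set.univ := by
    ext a
    simp only [Set.mem_Ici, Set.image_univ, Set.mem_range]
    constructor
    · intro h; exact ⟨a - b, add_tsub_cancel_of_le h⟩
    · rintro ⟨y, rfl⟩; exact le_self_add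
  rw [this, cnt_image]
  exact cnt_univ_evz hq _

lemma cnt_list_evz {m q : ℕ} (hq : 0 < q) (e : ℕ) : ∀ (k : ℕ) (l : List (Fin m → ℕ)), l.length = k →
    EvZ ((1 - PowerSeries.X ^ q) ^ m * cnt q e {a | ∃ b ∈ l, b ≤ a}) := by
  intro k
  induction k with
  | zero =>
    intro l hl
    rw [List.length_eq_zero_iff] at hl
    subst hl
    have : {a : Fin m → ℕ | ∃ b ∈ ([] : List (Fin m → ℕ)), b ≤ a} = ∅ := by ext; simp
    rw [this, cnt_empty, mul_zero]
    exact EvZ.zero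
  | succ k ih =>
    intro l hl
    obtain ⟨c, l, rfl⟩ := List.exists_cons_of_length_eq_add_one hl
    have h1 : {a | ∃ b ∈ c :: l, b ≤ a} = Set.Ici c ∪ {a | ∃ b ∈ l, b ≤ a} := by
      ext; simp
    have h2 : Set.Ici c ∩ {a | ∃ b ∈ l, b ≤ a} = {a | ∃ b ∈ l.map (fun b => c ⊔ b), b ≤ a} := by
      ext a; simp; tauto
    rw [h1, cnt_union hq, h2, mul_sub, mul_add]
    refine ((cnt_Ici_evz hq e c).add (ih l (by simpa using hl))).sub (ih _ (by simpa using hl))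

lemma cnt_upper_evz {m q : ℕ} (hq : 0 < q) (e : ℕ) (U : Set (Fin m → ℕ)) (hU : IsUpperSet U) :
    EvZ ((1 - PowerSeries.X ^ q) ^ m * cnt q e U) := by
  have hfin : {a | Minimal (· ∈ U) a}.Finite :=
    WellQuasiOrderedLE.finite_of_isAntichain (setOfPred_minimal_antichain _)
  have : U = {a | ∃ b ∈ hfin.toFinset.toList, b ≤ a} := by
    ext a
    simp only [Finset.mem_toList, Set.Finite.mem_toFinset, Set.mem_ofPred_eq]
    constructor
    · intro ha
      obtain ⟨b, hb, hm⟩ := exists_minimal_le_of_wellFoundedLT (· ∈ U) a ha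
      exact ⟨b, hm, hb⟩
    · rintro ⟨b, hb, hba⟩
      exact hU hba hb.prop
  rw [this]
  exact cnt_list_evz hq e _ _ rfl

lemma cnt_lower_evz {m q : ℕ} (hq : 0 < q) (e : ℕ) (U : Set (Fin m → ℕ)) (hU : IsUpperSet U) :
    EvZ ((1 - PowerSeries.X ^ q) ^ m * cnt q e Uᶜ) := by
  have h := cnt_union hq e U Uᶜ
  rw [Set.union_compl_self, Set.inter_compl_self, cnt_empty, sub_zero] at h
  have h2 : cnt q e Uᶜ = cnt q e (Set.univ : Set (Fin m → ℕ)) - cnt q e U := by rw [h]; ring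
  rw [h2, mul_sub]
  exact (cnt_univ_evz hq e).sub (cnt_upper_evz hq e U hU)

lemma hilb {α : Type*} {k m q : ℕ} (hq : 0 < q) (φ : Fin k → (Fin m → ℕ) → α)
    (hφ : ∀ f f' a a' b, φ f a = φ f' a' → φ f (a + b) = φ f' (a' + b))
    (e : Fin k → ℕ) (deg : α → ℕ) (hdeg : ∀ f a, deg (φ f a) = e f + q * ∑ i, a i) :
    EvZ ((1 - PowerSeries.X ^ q) ^ m *
      PowerSeries.mk fun n => (Set.ncard {x | (∃ f a, φ f a = x) ∧ deg x = n} : ℤ)) := by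
  let key : Fin k × (Fin m → ℕ) → Fin k ×ₗ Lex (Fin m → ℕ) := fun p => toLex (p.1, toLex p.2)
  have key_inj : Function.Injective key := by
    rintro ⟨f, a⟩ ⟨g, b⟩ h
    simp only [key, EmbeddingLike.apply_eq_iff_eq, Prod.mk.injEq] at h
    exact Prod.ext h.1 h.2
  let U : Fin k → Set (Fin m → ℕ) := fun f =>
    {a | ∃ f' a', φ f' a' = φ f a ∧ key (f', a') < key (f, a)}
  have hU : ∀ f, IsUpperSet (U f) := by
    rintro f a b hab ⟨f', a', h, hk⟩
    obtain ⟨c, rfl⟩ : ∃ c, b = a + c := ⟨b - a, (add_tsub_cancel_of_le hab).symm⟩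
    refine ⟨f', a' + c, hφ _ _ _ _ c h, ?_⟩
    simp only [key, Prod.Lex.toLex_lt_toLex] at hk ⊢
    refine hk.imp id (fun h => ⟨h.1, ?_⟩)
    have h3 := add_lt_add_left h.2 (toLex c)
    exact h3
  have hsum : (PowerSeries.mk fun n => (Set.ncard {x | (∃ f a, φ f a = x) ∧ deg x = n} : ℤ)) =
      ∑ f, cnt q (e f) (U f)ᶜ := by
    ext n
    simp only [cnt, PowerSeries.coeff_mk, map_sum]
    let T : Fin k → Set (Fin k × (Fin m → ℕ)) := fun f =>
      (fun a => (f, a)) '' {a ∈ (U f)ᶜ | e f + q * ∑ i, a i = n}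
    have hT : ∀ f, (T f).Finite := fun f => (cnt_fin hq _ _ _).image _
    have h1 : {x | (∃ f a, φ f a = x) ∧ deg x = n} = (fun p => φ p.1 p.2) '' (⋃ f, T f) := by
      ext x
      simp only [Set.mem_ofPred_eq, Set.mem_image, Set.mem_iUnion]
      constructor
      · rintro ⟨⟨f, a, hx⟩, hn⟩
        have hne : {p : Fin k × (Fin m → ℕ) | φ p.1 p.2 = x}.Nonempty := ⟨(f, a), hx⟩
        obtain ⟨p, hp, hmin⟩ := WellFounded.has_min (InvImage.wf key wellFounded_lt) _ hne
        refine ⟨p, ⟨p.1, p.2, ⟨?_, ?_⟩, rfl⟩, hp⟩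
        · rintro ⟨f', a', h, hk⟩
          exact hmin (f', a') (h.trans hp) hk
        · rw [← hdeg, ← hn]; congr 1
      · rintro ⟨p, ⟨f, a, ⟨ha, hn⟩, rfl⟩, rfl⟩
        exact ⟨⟨f, a, rfl⟩, by rw [hdeg, hn]⟩
    have h2 : Set.InjOn (fun p : Fin k × (Fin m → ℕ) => φ p.1 p.2) (⋃ f, T f) := by
      rintro p hp p' hp' h
      simp only [Set.mem_iUnion] at hp hp'
      obtain ⟨f, a, ⟨ha, -⟩, rfl⟩ := hp
      obtain ⟨f', a', ⟨ha', -⟩, rfl⟩ := hp'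
      simp only at h
      rcases lt_trichotomy (key (f, a)) (key (f', a')) with hk | hk | hk
      · exact absurd ⟨f, a, h, hk⟩ ha'
      · exact key_inj hk
      · exact absurd ⟨f', a', h.symm, hk⟩ ha
    rw [h1, h2.ncard_image]
    have h3 : (⋃ f, T f).ncard = ∑ f, (T f).ncard := by
      rw [Set.ncard_iUnion_of_finite hT, finsum_eq_sum_of_fintype]
      intro f g hfg
      rw [Function.onFun, Set.disjoint_left]
      rintro _ ⟨a, _, rfl⟩ ⟨b, _, hb⟩
      exact hfg (congrArg Prod.fst hb).symm
    rw [h3]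
    push_cast
    refine Finset.sum_congr rfl fun f _ => ?_
    rw [Set.ncard_image_of_injective _ (Prod.mk_right_injective f)]
  rw [hsum, Finset.mul_sum]
  have : ∀ s : Finset (Fin k), EvZ (∑ f ∈ s, (1 - PowerSeries.X ^ q) ^ m * cnt q (e f) (U f)ᶜ) := by
    intro s
    induction s using Finset.cons_induction with
    | empty => exact EvZ.zero
    | cons f s hf ih =>
      rw [Finset.sum_cons]
      exact (cnt_lower_evz hq _ _ (hU f)).add ih
  exact this _

def Mset {d m : ℕ} (q : ℕ) (w : Fin m → Fin d → ℝ) (n : ℕ) : Set (Fin d → ℝ) :=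
  {x | IsLatticePt x ∧ ∃ c : Fin m → ℝ, (∀ i, 0 ≤ c i) ∧ (q : ℝ) * ∑ i, c i = n ∧ x = ∑ i, c i • w i}

lemma Mset_bound {d m q : ℕ} (hq : 0 < q) (w : Fin m → Fin d → ℝ) :
    ∃ C : ℕ, ∀ n, (Mset q w n).Finite ∧ (Mset q w n).ncard ≤ C * (n + 1) ^ d := by
  obtain ⟨C, hC⟩ := exists_nat_ge (∑ i, ∑ j, |w i j|)
  have hw : ∀ i j, |w i j| ≤ C := fun i j =>
    ((Finset.single_le_sum (f := fun j => |w i j|) (fun _ _ => abs_nonneg _) (Finset.mem_univ j)).trans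
      (Finset.single_le_sum (f := fun i => ∑ j, |w i j|)
        (fun _ _ => Finset.sum_nonneg fun _ _ => abs_nonneg _) (Finset.mem_univ i))).trans hC
  refine ⟨(2 * C + 1) ^ d, fun n => ?_⟩
  let B : Finset (Fin d → ℤ) := Fintype.piFinset fun _ => Finset.Icc (-((C * n : ℕ) : ℤ)) ((C * n : ℕ) : ℤ)
  let g : (Fin d → ℤ) → (Fin d → ℝ) := fun z j => (z j : ℝ)
  have hsub : Mset q w n ⊆ g '' (B : Set (Fin d → ℤ)) := by
    rintro x ⟨hx, c, hc0, hcs, hxc⟩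
    choose z hz using hx
    refine ⟨z, ?_, by ext j; exact (hz j).symm⟩
    rw [Finset.mem_coe, Fintype.mem_piFinset]
    intro j
    have hq1 : (1 : ℝ) ≤ q := by exact_mod_cast hq
    have hcsn : 0 ≤ ∑ i, c i := Finset.sum_nonneg fun i _ => hc0 i
    have h1 : |x j| ≤ C * n := by
      rw [hxc, Finset.sum_apply]
      calc |∑ i, (c i • w i) j| ≤ ∑ i, |(c i • w i) j| := Finset.abs_sum_le_sum_abs _ _
        _ ≤ ∑ i, c i * C := by
          refine Finset.sum_le_sum fun i _ => ?_
          rw [Pi.smul_apply, smul_eq_mul, abs_mul, abs_of_nonneg (hc0 i)]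
          exact mul_le_mul_of_nonneg_left (hw i j) (hc0 i)
        _ = C * ∑ i, c i := by rw [← Finset.sum_mul, mul_comm]
        _ ≤ C * n := by
          refine mul_le_mul_of_nonneg_left ?_ (by positivity)
          nlinarith
    rw [hz j, abs_le] at h1
    rw [Finset.mem_Icc]
    constructor
    · have := h1.1; exact_mod_cast this
    · have := h1.2; exact_mod_cast this
  have hfin : (g '' (B : Set (Fin d → ℤ))).Finite := B.finite_toSet.image g
  refine ⟨hfin.subset hsub, ?_⟩
  calc (Mset q w n).ncard ≤ (g '' (B : Set (Fin d → ℤ))).ncard := Set.ncard_le_ncard hsub hfin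
    _ ≤ (B : Set (Fin d → ℤ)).ncard := Set.ncard_image_le B.finite_toSet
    _ = B.card := Set.ncard_coe_finset B
    _ = (2 * (C * n) + 1) ^ d := by
      rw [Fintype.card_piFinset]
      simp only [Int.card_Icc, Finset.prod_const, Finset.card_univ, Fintype.card_fin]
      congr 1
      omega
    _ ≤ (2 * C + 1) ^ d * (n + 1) ^ d := by
      rw [← mul_pow]
      refine Nat.pow_le_pow_left ?_ d
      nlinarith

lemma Mset_add {d m q : ℕ} (w : Fin m → Fin d → ℝ) (hw : ∀ i, IsLatticePt (w i)) {n : ℕ}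
    {x : Fin d → ℝ} (hx : x ∈ Mset q w n) (a : Fin m → ℕ) :
    x + ∑ i, (a i : ℝ) • w i ∈ Mset q w (n + q * ∑ i, a i) := by
  obtain ⟨hl, c, hc0, hcs, hxc⟩ := hx
  refine ⟨fun j => ?_, fun i => c i + a i, fun i => add_nonneg (hc0 i) (Nat.cast_nonneg _), ?_, ?_⟩
  · choose z hz using hl
    choose y hy using hw
    refine ⟨z j + ∑ i, a i * y i j, ?_⟩
    simp [hz, hy, Finset.sum_apply]
  · rw [Finset.sum_add_distrib, mul_add, hcs]; push_cast; rfl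
  · simp only [add_smul, Finset.sum_add_distrib, ← hxc]

lemma Mset_decomp {d m q : ℕ} (w : Fin m → Fin d → ℝ) (hw : ∀ i, IsLatticePt (w i)) {n : ℕ}
    {x : Fin d → ℝ} (hx : x ∈ Mset q w n) :
    ∃ n₀ ≤ q * m, ∃ x₀ ∈ Mset q w n₀, ∃ a : Fin m → ℕ,
      x = x₀ + ∑ i, (a i : ℝ) • w i ∧ n = n₀ + q * ∑ i, a i := by
  obtain ⟨hl, c, hc0, hcs, hxc⟩ := hx
  let a : Fin m → ℕ := fun i => ⌊c i⌋₊
  have ha : ∀ i, (a i : ℝ) ≤ c i := fun i => Nat.floor_le (hc0 i)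
  have ha' : ∀ i, c i < a i + 1 := fun i => Nat.lt_floor_add_one _
  have hle : q * ∑ i, a i ≤ n := by
    have : (q : ℝ) * ∑ i, (a i : ℝ) ≤ n := by
      rw [← hcs]
      exact mul_le_mul_of_nonneg_left (Finset.sum_le_sum fun i _ => ha i) (Nat.cast_nonneg _)
    exact_mod_cast this
  obtain ⟨n₀, rfl⟩ := Nat.exists_eq_add_of_le hle
  have hs : (q : ℝ) * ∑ i, (c i - a i) = n₀ := by
    rw [Finset.sum_sub_distrib, mul_sub, hcs]; push_cast; ring
  refine ⟨n₀, ?_, x - ∑ i, (a i : ℝ) • w i, ⟨fun j => ?_, fun i => c i - a i,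
    fun i => sub_nonneg.2 (ha i), hs, ?_⟩, a, ?_, add_comm _ _⟩
  · have : (n₀ : ℝ) ≤ q * m := by
      rw [← hs]
      refine mul_le_mul_of_nonneg_left ?_ (Nat.cast_nonneg _)
      calc ∑ i, (c i - a i) ≤ ∑ i : Fin m, (1 : ℝ) :=
            Finset.sum_le_sum fun i _ => by linarith [ha' i]
        _ = m := by simp
    exact_mod_cast this
  · choose z hz using hl
    choose y hy using hw
    refine ⟨z j - ∑ i, a i * y i j, ?_⟩
    simp [hz, hy, Finset.sum_apply]
  · simp only [sub_smul, Finset.sum_sub_distrib, ← hxc]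
  · simp

lemma Mset_evz {d m q : ℕ} (hq : 0 < q) (w : Fin m → Fin d → ℝ) (hw : ∀ i, IsLatticePt (w i)) :
    EvZ ((1 - PowerSeries.X ^ q) ^ m * PowerSeries.mk fun n => ((Mset q w n).ncard : ℤ)) := by
  obtain ⟨C, hC⟩ := Mset_bound hq w
  let F : Set (ℕ × (Fin d → ℝ)) := ⋃ n ∈ Set.Iic (q * m), (fun x => (n, x)) '' Mset q w n
  have hF : F.Finite := (Set.finite_Iic _).biUnion fun n _ => (hC n).1.image _
  have hFm : ∀ p, p ∈ F ↔ p.1 ≤ q * m ∧ p.2 ∈ Mset q w p.1 := by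
    rintro ⟨n, x⟩
    simp only [F, Set.mem_iUnion, Set.mem_image, Set.mem_Iic, Prod.mk.injEq]
    constructor
    · rintro ⟨n, h, x, hx, rfl, rfl⟩; exact ⟨h, hx⟩
    · rintro ⟨h, hx⟩; exact ⟨n, h, x, hx, rfl, rfl⟩
  obtain ⟨k, f, hf⟩ : ∃ (k : ℕ) (f : Fin k → ℕ × (Fin d → ℝ)), Set.range f = F := by
    obtain ⟨k, f, hf⟩ := hF.fin_embedding
    exact ⟨k, f, hf⟩
  have key := hilb hq (fun (t : Fin k) (a : Fin m → ℕ) =>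
    (((f t).1 + q * ∑ i, a i, (f t).2 + ∑ i, (a i : ℝ) • w i) : ℕ × (Fin d → ℝ))) ?_
    (fun t => (f t).1) Prod.fst (fun _ _ => rfl)
  · convert key using 4 with n
    rw [← Set.ncard_image_of_injective _ (Prod.mk_right_injective n)]
    congr 2
    ext ⟨n', x⟩
    simp only [Set.mem_image, Set.mem_ofPred_eq, Prod.mk.injEq]
    constructor
    · rintro ⟨x, hx, rfl, rfl⟩
      obtain ⟨n₀, hn₀, x₀, hx₀, a, h1, h2⟩ := Mset_decomp w hw hx
      have : ((n₀, x₀) : ℕ × (Fin d → ℝ)) ∈ Set.range f := by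
        rw [hf, hFm]; exact ⟨hn₀, hx₀⟩
      obtain ⟨t, ht⟩ := this
      exact ⟨⟨t, a, by rw [ht]; exact h2.symm, by rw [ht]; exact h1.symm⟩, rfl⟩
    · rintro ⟨⟨t, a, h1, h2⟩, rfl⟩
      refine ⟨x, ?_, rfl, rfl⟩
      have : f t ∈ F := hf ▸ Set.mem_range_self t
      rw [hFm] at this
      rw [← h1, ← h2]
      exact Mset_add w hw this.2 a
  · intro t t' a a' b h
    simp only [Prod.mk.injEq] at h ⊢
    constructor
    · simp only [Pi.add_apply, Finset.sum_add_distrib, mul_add]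
      have := h.1; omega
    · simp only [Pi.add_apply, Nat.cast_add, add_smul, Finset.sum_add_distrib, ← add_assoc, h.2]

lemma Mset_final {d m q : ℕ} (hq : 0 < q) (w : Fin m → Fin d → ℝ) (hw : ∀ i, IsLatticePt (w i)) :
    EvZ ((1 - PowerSeries.X ^ q) ^ (d + 1) * PowerSeries.mk fun n => ((Mset q w n).ncard : ℤ)) := by
  obtain ⟨C, hC⟩ := Mset_bound hq w
  refine (Mset_evz hq w hw).growth C fun n => ?_
  rw [PowerSeries.coeff_mk, abs_of_nonneg (by positivity)]
  exact_mod_cast (hC n).2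

lemma exists_Mset {d q : ℕ} (P : Set (Fin d → ℝ)) (hq : 0 < q) (hne : P.Nonempty)
    (hP : IsLatticePolytope ((q : ℝ) • P)) : ∃ (m : ℕ) (w : Fin m → Fin d → ℝ),
      (∀ i, IsLatticePt (w i)) ∧
      ∀ n : ℕ, {x ∈ (n : ℝ) • P | IsLatticePt x} = Mset q w n := by
  obtain ⟨V, hV, hPV⟩ := hP
  have hq' : (q : ℝ) ≠ 0 := by positivity
  let w : Fin V.card → Fin d → ℝ := fun i => (V.equivFin.symm i : Fin d → ℝ)
  have hwV : ∀ i, w i ∈ V := fun i => (V.equivFin.symm i).2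
  have hsum : ∀ {E : Type} [AddCommMonoid E] (g : (Fin d → ℝ) → E),
      ∑ y ∈ V, g y = ∑ i, g (w i) := by
    intro E _ g
    rw [← Finset.sum_coe_sort, ← Equiv.sum_comp V.equivFin.symm]
  refine ⟨V.card, w, fun i => hV _ (hwV i), fun n => ?_⟩
  ext x
  simp only [Mset, Set.mem_ofPred_eq]
  rw [and_comm]
  refine and_congr_right fun hx => ?_
  constructor
  · rintro ⟨p, hp, rfl⟩
    have hp' : (q : ℝ) • p ∈ (q : ℝ) • P := Set.smul_mem_smul_set hp
    rw [hPV, Finset.mem_convexHull'] at hp'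
    obtain ⟨l, hl0, hl1, hl⟩ := hp'
    rw [hsum] at hl1 hl
    refine ⟨fun i => n / q * l (w i), fun i => mul_nonneg (by positivity) (hl0 _ (hwV i)), ?_, ?_⟩
    · rw [← Finset.mul_sum, hl1]; field_simp
    · simp only [mul_smul, ← Finset.smul_sum]
      rw [hl, smul_smul]
      congr 1
      field_simp
  · rintro ⟨c, hc0, hcs, hxc⟩
    rcases Nat.eq_zero_or_pos n with rfl | hn
    · have h0 : ∑ i, c i = 0 := by
        have : (q : ℝ) * ∑ i, c i = 0 := by simpa using hcs
        exact (mul_eq_zero.1 this).resolve_left hq'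
      rw [Finset.sum_eq_zero_iff_of_nonneg (fun i _ => hc0 i)] at h0
      have hx0 : x = 0 := by
        rw [hxc]; exact Finset.sum_eq_zero fun i hi => by rw [h0 i hi, zero_smul]
      rw [Nat.cast_zero, Set.zero_smul_set hne, hx0]; rfl
    · have hn' : (n : ℝ) ≠ 0 := by positivity
      have h1 : ((q : ℝ) / n) • x ∈ (q : ℝ) • P := by
        rw [hPV, hxc, Finset.smul_sum]
        simp only [smul_smul]
        refine (convex_convexHull ℝ _).sum_mem (fun i _ => mul_nonneg (by positivity) (hc0 i)) ?_
          (fun i _ => subset_convexHull ℝ _ (hwV i))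
        rw [← Finset.mul_sum, div_mul_eq_mul_div, hcs, div_self hn']
      obtain ⟨p, hp, h⟩ := h1
      refine ⟨p, hp, ?_⟩
      simp only at h ⊢
      have : x = ((n : ℝ) / q) • ((q : ℝ) / n) • x := by
        rw [smul_smul]; field_simp; simp
      rw [this, ← h, smul_smul]
      congr 1
      field_simp

lemma coeff_ehr {d : ℕ} {P : Set (Fin d → ℝ)} (hne : P.Nonempty) (n : ℕ) :
    PowerSeries.coeff n (ehrSeries P) = (latCount ((n : ℝ) • P) : ℤ) := by
  rw [ehrSeries, PowerSeries.coeff_mk]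
  split_ifs with h
  · subst h
    rw [Nat.cast_zero, Set.zero_smul_set hne, latCount]
    have : {x ∈ (0 : Set (Fin d → ℝ)) | IsLatticePt x} = {0} := by
      ext x
      simp only [Set.mem_ofPred_eq, Set.mem_zero, Set.mem_singleton_iff, and_iff_left_iff_imp]
      rintro rfl i
      exact ⟨0, by simp⟩
    rw [this]; simp
  · rfl

lemma mem_pyr {d : ℕ} {P : Set (Fin d → ℝ)} (hne : P.Nonempty) (hconv : Convex ℝ P)
    (z : Fin (d + 1) → ℝ) :
    z ∈ convexHull ℝ
          (((fun y : Fin d → ℝ => (Fin.snoc y 0 : Fin (d + 1) → ℝ)) '' P) ∪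
            {(Fin.snoc (0 : Fin d → ℝ) 1 : Fin (d + 1) → ℝ)}) ↔
    ∃ a b : ℝ, 0 ≤ a ∧ 0 ≤ b ∧ a + b = 1 ∧ ∃ p ∈ P, z = Fin.snoc (a • p) b := by
  have himg : Convex ℝ ((fun y : Fin d → ℝ => (Fin.snoc y 0 : Fin (d + 1) → ℝ)) '' P) := by
    rintro _ ⟨x, hx, rfl⟩ _ ⟨y, hy, rfl⟩ a b ha hb hab
    refine ⟨a • x + b • y, hconv hx hy ha hb hab, ?_⟩
    ext i
    refine Fin.lastCases ?_ (fun i => ?_) i <;> simp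
  rw [convexHull_union (hne.image _) (Set.singleton_nonempty _), himg.convexHull_eq,
    convexHull_singleton, mem_convexJoin]
  have hs : ∀ (a b : ℝ) (p : Fin d → ℝ), a • (Fin.snoc p 0 : Fin (d + 1) → ℝ) +
      b • (Fin.snoc (0 : Fin d → ℝ) 1 : Fin (d + 1) → ℝ) = Fin.snoc (a • p) b := by
    intro a b p
    ext i
    refine Fin.lastCases ?_ (fun i => ?_) i <;> simp
  constructor
  · rintro ⟨_, ⟨p, hp, rfl⟩, _, rfl, a, b, ha, hb, hab, rfl⟩
    exact ⟨a, b, ha, hb, hab, p, hp, hs a b p⟩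
  · rintro ⟨a, b, ha, hb, hab, p, hp, rfl⟩
    exact ⟨_, ⟨p, hp, rfl⟩, _, rfl, a, b, ha, hb, hab, hs a b p⟩

lemma pyr_set {d : ℕ} {P : Set (Fin d → ℝ)} (hne : P.Nonempty) (hconv : Convex ℝ P) (n : ℕ) :
    {y ∈ (n : ℝ) • convexHull ℝ
          (((fun y : Fin d → ℝ => (Fin.snoc y 0 : Fin (d + 1) → ℝ)) '' P) ∪
            {(Fin.snoc (0 : Fin d → ℝ) 1 : Fin (d + 1) → ℝ)}) | IsLatticePt y} =
    ⋃ p ∈ (Finset.HasAntidiagonal.antidiagonal n : Set (ℕ × ℕ)),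
      (fun x : Fin d → ℝ => (Fin.snoc x (p.1 : ℝ) : Fin (d + 1) → ℝ)) ''
        {x ∈ (p.2 : ℝ) • P | IsLatticePt x} := by
  have hsm : ∀ (c b : ℝ) (x : Fin d → ℝ), c • (Fin.snoc x b : Fin (d + 1) → ℝ) =
      Fin.snoc (c • x) (c * b) := by
    intro c b x
    ext i
    refine Fin.lastCases ?_ (fun i => ?_) i <;> simp
  ext y
  simp only [Set.mem_ofPred_eq, Set.mem_iUnion, Set.mem_image, Finset.mem_coe,
    Finset.HasAntidiagonal.mem_antidiagonal, Set.mem_smul_set, mem_pyr hne hconv]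
  constructor
  · rintro ⟨⟨z, ⟨a, b, ha, hb, hab, p, hp, rfl⟩, rfl⟩, hl⟩
    rw [hsm] at hl ⊢
    obtain ⟨t, ht⟩ := hl (Fin.last d)
    rw [Fin.snoc_last] at ht
    have ht0 : 0 ≤ t := by
      have : (0 : ℝ) ≤ t := by rw [← ht]; positivity
      exact_mod_cast this
    lift t to ℕ using ht0
    rw [Int.cast_natCast] at ht
    have htn : t ≤ n := by
      have : (t : ℝ) ≤ n := by
        rw [← ht]; have : (0:ℝ) ≤ n := Nat.cast_nonneg n
        nlinarith
      exact_mod_cast this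
    refine ⟨(t, n - t), by simp only; omega, (n : ℝ) • a • p, ⟨⟨p, hp, ?_⟩, fun i => ?_⟩, ?_⟩
    · simp only
      rw [smul_smul, Nat.cast_sub htn, ← ht]
      congr 1
      rw [show a = 1 - b by linarith]; ring
    · have := hl i.castSucc
      rwa [Fin.snoc_castSucc] at this
    · simp only; rw [ht]
  · rintro ⟨⟨t, s⟩, hts, x, ⟨⟨p, hp, rfl⟩, hl⟩, rfl⟩
    simp only at hts hl ⊢
    subst hts
    refine ⟨?_, fun i => ?_⟩
    · rcases Nat.eq_zero_or_pos (t + s) with h | h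
      · obtain ⟨rfl, rfl⟩ : t = 0 ∧ s = 0 := by omega
        refine ⟨_, ⟨1, 0, by simp, by simp, by simp, p, hp, rfl⟩, ?_⟩
        rw [hsm]; simp
      · have h' : ((t + s : ℕ) : ℝ) ≠ 0 := by positivity
        refine ⟨_, ⟨s / ((t + s : ℕ) : ℝ), t / ((t + s : ℕ) : ℝ), by positivity, by positivity,
          ?_, p, hp, rfl⟩, ?_⟩
        · rw [← add_div, div_eq_one_iff_eq h']; push_cast; ring
        · rw [hsm, smul_smul, mul_div_cancel₀ _ h', mul_div_cancel₀ _ h']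
    · refine Fin.lastCases ⟨t, by simp⟩ (fun i => ?_) i
      simp only [Fin.snoc_castSucc]
      exact hl i

lemma pyr_ehr {d : ℕ} {P : Set (Fin d → ℝ)} (hne : P.Nonempty) (hconv : Convex ℝ P)
    (hfin : ∀ n : ℕ, {x ∈ (n : ℝ) • P | IsLatticePt x}.Finite) :
    (1 - PowerSeries.X) * ehrSeries (convexHull ℝ
          (((fun y : Fin d → ℝ => (Fin.snoc y 0 : Fin (d + 1) → ℝ)) '' P) ∪
            {(Fin.snoc (0 : Fin d → ℝ) 1 : Fin (d + 1) → ℝ)})) = ehrSeries P := by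
  have h : ehrSeries (convexHull ℝ
          (((fun y : Fin d → ℝ => (Fin.snoc y 0 : Fin (d + 1) → ℝ)) '' P) ∪
            {(Fin.snoc (0 : Fin d → ℝ) 1 : Fin (d + 1) → ℝ)})) = PowerSeries.mk 1 * ehrSeries P := by
    ext n
    have hne' : (convexHull ℝ
          (((fun y : Fin d → ℝ => (Fin.snoc y 0 : Fin (d + 1) → ℝ)) '' P) ∪
            {(Fin.snoc (0 : Fin d → ℝ) 1 : Fin (d + 1) → ℝ)})).Nonempty := by
      rw [convexHull_nonempty_iff]
      exact ⟨_, Or.inr rfl⟩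
    have hinj : ∀ c : ℝ, Function.Injective
        (fun x : Fin d → ℝ => (Fin.snoc x c : Fin (d + 1) → ℝ)) := by
      intro c x y hxy
      ext i
      have := congrFun hxy i.castSucc
      simpa using this
    rw [coeff_ehr hne', latCount, pyr_set hne hconv, PowerSeries.coeff_mul,
      (Finset.finite_toSet _).ncard_biUnion (fun p _ => (hfin _).image _), finsum_mem_coe_finset]
    · push_cast
      refine Finset.sum_congr rfl fun p _ => ?_
      rw [coeff_ehr hne, PowerSeries.coeff_mk, Set.ncard_image_of_injective _ (hinj _)]
      simp [latCount]
    · rintro ⟨t, s⟩ hp ⟨t', s'⟩ hp' hpp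
      rw [Function.onFun, Set.disjoint_left]
      rintro _ ⟨x, _, rfl⟩ ⟨x', _, hx⟩
      have := congrFun hx (Fin.last d)
      simp only [Fin.snoc_last, Nat.cast_inj] at this
      simp only [Finset.mem_coe, Finset.HasAntidiagonal.mem_antidiagonal] at hp hp'
      apply hpp
      rw [Prod.mk.injEq]; omega
  rw [h, ← mul_assoc, mul_comm (1 - PowerSeries.X), PowerSeries.mk_one_mul_one_sub_eq_one, one_mul]

/-- **Statement 10.** (Lattice-apex pyramids preserve the h*-polynomial.) Let `P ⊆ ℝ^d` be
a full-dimensional rational polytope with denominator `q`, embedded in `ℝ^{d+1}` by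
appending a last coordinate `0`, and let `Pyr(e_{d+1}, P) = conv(P ∪ {e_{d+1}})` be the
pyramid with apex the last standard basis vector.  Then `(1−z^q)^{d+1} Ehr_P(z)` and
`(1−z^q)^{d+1}(1−z) Ehr_{Pyr(e_{d+1},P)}(z)` are polynomials and they are equal. -/
theorem pyramid_hstar_eq {d q : ℕ} (P : Set (Fin d → ℝ))
    (hrat : IsRationalPolytope P) (hfull : IsFullDim P) (hq : IsDenominator P q) :
    ∃ h : Polynomial ℤ,
      (h : PowerSeries ℤ) = (1 - PowerSeries.X ^ q) ^ (d + 1) * ehrSeries P ∧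
      (h : PowerSeries ℤ) = (1 - PowerSeries.X ^ q) ^ (d + 1) * (1 - PowerSeries.X) *
        ehrSeries (convexHull ℝ
          (((fun y : Fin d → ℝ => (Fin.snoc y 0 : Fin (d + 1) → ℝ)) '' P) ∪
            {(Fin.snoc (0 : Fin d → ℝ) 1 : Fin (d + 1) → ℝ)})) := by
  obtain ⟨hq0, hqP, -⟩ := hq
  have hne : P.Nonempty := hfull.mono interior_subset
  have hconv : Convex ℝ P := by
    obtain ⟨V, _, rfl⟩ := hrat
    exact convex_convexHull ℝ _
  obtain ⟨m, w, hw, hM⟩ := exists_Mset P hq0 hne hqP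
  have hE : ehrSeries P = PowerSeries.mk fun n => ((Mset q w n).ncard : ℤ) := by
    ext n
    rw [coeff_ehr hne, PowerSeries.coeff_mk, latCount, hM]
  obtain ⟨C, hC⟩ := Mset_bound hq0 w
  obtain ⟨h, hh⟩ := (Mset_final hq0 w hw).poly
  refine ⟨h, by rw [hh, hE], ?_⟩
  rw [mul_assoc, pyr_ehr hne hconv (fun n => by rw [hM]; exact (hC n).1), hh, hE]
end

section
/- Let P ⊂ ℝ^{d−1} be a full-dimensional rational polytope with denominator q, regarded as a subset of ℝ^d via the embedding appending a last coordinate 0, let r be a positive integer, and let x ∈ (1/r)ℤ^d be a point not lying in the hyperplane spanned by P. Let Pyr(x, P) := conv(P ∪ {x}). Then h*_P(z) := (1−z^q)^d·Ehr_P(z) and h*_{Pyr(x,P)}(z) := (1−z^q)^d(1−z^r)·Ehr_{Pyr(x,P)}(z) are polynomials and h*_P(z) ≤ h*_{Pyr(x,P)}(z) coefficient-wise. -/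
open Pointwise

namespace PyrAux

/-- Combined lexicographic positivity. -/
def LexPos (a b : ℝ) : Prop := 0 < a ∨ (a = 0 ∧ 0 < b)

structure IsBase {ι E : Type*} [Fintype ι] [DecidableEq ι] [AddCommGroup E] [Module ℝ E]
    (w : ι → E) (n : ℕ) (s : Finset ι) (c : ι → E →ₗ[ℝ] ℝ) : Prop where
  off : ∀ i, i ∉ s → c i = 0
  rep : ∀ y, ∑ i, c i y • w i = y
  dual : ∀ i, i ∈ s → ∀ j, j ∈ s → c i (w j) = if i = j then 1 else 0
  card : s.card = n

theorem exists_generic {ι κ : Type*} [Fintype ι] [Finite κ] (f : κ → ι → ℝ)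
    (hf : ∀ k, f k ≠ 0) : ∃ a : ι → ℝ, (∀ i, 0 < a i) ∧ ∀ k, ∑ i, a i * f k i ≠ 0 := by
  classical
  cases nonempty_fintype κ
  let e := Fintype.equivFin ι
  let p : κ → Polynomial ℝ := fun k => ∑ i, Polynomial.C (f k i) * Polynomial.X ^ (e i : ℕ)
  have hp : ∀ k, p k ≠ 0 := by
    intro k h
    apply hf k
    funext i
    have h1 : (p k).coeff (e i : ℕ) = 0 := by rw [h]; simp
    simp only [p, Polynomial.finsetSum_coeff, Polynomial.coeff_C_mul, Polynomial.coeff_X_pow] at h1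
    rw [Finset.sum_eq_single i] at h1
    · simpa using h1
    · intro j _ hj
      have : (e i : ℕ) ≠ (e j : ℕ) := fun h => hj (e.injective (Fin.ext h.symm))
      simp [this]
    · simp
  have hfin : (⋃ k, {t : ℝ | (p k).IsRoot t}).Finite :=
    Set.finite_iUnion fun k => Polynomial.finite_setOfPred_isRoot (hp k)
  obtain ⟨t, ht, ht'⟩ := (Set.Ioi_infinite (0 : ℝ)).exists_notMem_finite hfin
  refine ⟨fun i => t ^ (e i : ℕ), fun i => pow_pos ht _, fun k h => ht' ?_⟩
  refine Set.mem_iUnion.2 ⟨k, ?_⟩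
  simp only [Set.mem_ofPred_eq, Polynomial.IsRoot.def, p, Polynomial.eval_finsetSum,
    Polynomial.eval_mul, Polynomial.eval_C, Polynomial.eval_pow, Polynomial.eval_X]
  rw [← h]
  exact Finset.sum_congr rfl fun i _ => mul_comm _ _

theorem lexPos_eventually (a b : ℝ) (hb : b ≠ 0) :
    ∀ᶠ e in nhdsWithin (0 : ℝ) (Set.Ioi 0), (0 < a + e * b ↔ LexPos a b) ∧ a + e * b ≠ 0 := by
  have hc : Filter.Tendsto (fun e : ℝ => a + e * b) (nhdsWithin (0 : ℝ) (Set.Ioi 0)) (nhds a) := by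
    have : Continuous (fun e : ℝ => a + e * b) := by fun_prop
    have h := this.tendsto 0
    simp only [zero_mul, add_zero] at h
    exact h.mono_left nhdsWithin_le_nhds
  rcases lt_trichotomy a 0 with h | h | h
  · filter_upwards [hc.eventually (gt_mem_nhds h)] with e he
    refine ⟨⟨fun h1 => absurd h1 (by linarith), ?_⟩, he.ne⟩
    rintro (h1 | h1)
    · linarith
    · linarith [h1.1]
  · subst h
    filter_upwards [self_mem_nhdsWithin] with e he
    have he : 0 < e := he
    refine ⟨⟨fun h1 => Or.inr ⟨rfl, ?_⟩, ?_⟩, ?_⟩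
    · rw [zero_add] at h1
      exact (pos_iff_pos_of_mul_pos h1).1 he
    · rintro (h1 | h1)
      · exact absurd h1 (lt_irrefl _)
      · rw [zero_add]; exact mul_pos he h1.2
    · rw [zero_add]; exact mul_ne_zero he.ne' hb
  · filter_upwards [hc.eventually (lt_mem_nhds h)] with e he
    exact ⟨⟨fun _ => Or.inl h, fun _ => he⟩, he.ne'⟩

section tri
variable {ι E : Type*} [Fintype ι] [DecidableEq ι] [AddCommGroup E] [Module ℝ E]
  {w : ι → E} {n : ℕ}

theorem IsBase.unique {s : Finset ι} {c c' : ι → E →ₗ[ℝ] ℝ} (h : IsBase w n s c)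
    (h' : IsBase w n s c') : c = c' := by
  funext i
  by_cases hi : i ∈ s
  · ext y
    conv_lhs => rw [← h'.rep y]
    rw [map_sum, Finset.sum_eq_single i]
    · simp [h.dual i hi i hi]
    · intro j _ hj
      by_cases hjs : j ∈ s
      · simp [h.dual i hi j hjs, hj.symm]
      · simp [h'.off j hjs]
    · simp
  · rw [h.off i hi, h'.off i hi]

theorem exists_isBase (s : Finset ι) (hs : LinearIndepOn ℝ w (s : Set ι))
    (hsp : Submodule.span ℝ (w '' (s : Set ι)) = ⊤) (hn : Module.finrank ℝ E = n) :
    ∃ c, IsBase w n s c := by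
  let b : Module.Basis s ℝ E := Module.Basis.mk (v := fun i : s => w i) hs (by
    rw [Set.image_eq_range] at hsp
    exact hsp.ge)
  have hb : ∀ i : s, b i = w i := fun i => Module.Basis.mk_apply _ _ i
  refine ⟨fun i => if h : i ∈ s then b.coord ⟨i, h⟩ else 0, ?_, ?_, ?_, ?_⟩
  · intro i hi; simp [hi]
  · intro y
    conv_rhs => rw [← b.sum_repr y]
    rw [← Finset.sum_subset (Finset.subset_univ s), ← Finset.sum_coe_sort s]
    · refine Finset.sum_congr rfl fun i _ => ?_
      simp [hb]
    · intro i _ hi; simp [hi]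
  · intro i hi j hj
    have : w j = b ⟨j, hj⟩ := (hb ⟨j, hj⟩).symm
    simp only [hi, dif_pos, this, Module.Basis.coord_apply, Module.Basis.repr_self, Finsupp.single_apply,
      Subtype.mk.injEq]
    simp [eq_comm]
  · rw [← hn, Module.finrank_eq_card_basis b]; simp

/-- Conic Caratheodory. -/
theorem conic_carath (ht : E →ₗ[ℝ] ℝ) {q : ℝ} (hq : 0 < q) (hw : ∀ i, ht (w i) = q) (y : E) :
    ∀ (m : ℕ) (a : ι → ℝ), (∀ i, 0 ≤ a i) → ∑ i, a i • w i = y →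
      (Finset.univ.filter fun i => a i ≠ 0).card = m →
      ∃ a' : ι → ℝ, (∀ i, 0 ≤ a' i) ∧ ∑ i, a' i • w i = y ∧
        LinearIndepOn ℝ w ((Finset.univ.filter fun i => a' i ≠ 0 : Finset ι) : Set ι) := by
  intro m
  induction m using Nat.strong_induction_on with
  | _ m ih =>
  intro a ha hy hm
  by_cases hli : LinearIndepOn ℝ w ((Finset.univ.filter fun i => a i ≠ 0 : Finset ι) : Set ι)
  · exact ⟨a, ha, hy, hli⟩
  rw [linearIndepOn_finset_iff] at hli
  push Not at hli
  obtain ⟨f, hf, i₁, hi₁, hfi₁⟩ := hli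
  let g : ι → ℝ := fun i => if a i ≠ 0 then f i else 0
  have hg : ∑ i, g i • w i = 0 := by
    rw [← hf, Finset.sum_filter]
    refine Finset.sum_congr rfl fun i _ => ?_
    simp only [g]; split_ifs <;> simp
  have hgs : ∑ i, g i = 0 := by
    have h1 := congrArg ht hg
    simp only [map_sum, map_smul, hw, smul_eq_mul, map_zero] at h1
    rw [← Finset.sum_mul] at h1
    exact (mul_eq_zero.1 h1).resolve_right hq.ne'
  have hpos : ∃ i, 0 < g i := by
    by_contra hcon
    push Not at hcon
    have h2 := (Finset.sum_eq_zero_iff_of_nonpos (fun i _ => hcon i)).1 hgs i₁ (Finset.mem_univ _)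
    simp only [Finset.mem_filter, Finset.mem_univ, true_and] at hi₁
    simp only [g, if_pos hi₁] at h2
    exact hfi₁ h2
  obtain ⟨i₂, hi₂⟩ := hpos
  obtain ⟨i₀, hi₀, hmin⟩ := Finset.exists_min_image (Finset.univ.filter fun i => 0 < g i)
    (fun i => a i / g i) ⟨i₂, by simpa using hi₂⟩
  simp only [Finset.mem_filter, Finset.mem_univ, true_and] at hi₀ hmin
  let t := a i₀ / g i₀
  have ht0 : 0 ≤ t := div_nonneg (ha _) hi₀.le
  have hai₀ : a i₀ ≠ 0 := by
    intro h; simp [g, h] at hi₀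
  refine ih ((Finset.univ.filter fun i => a i - t * g i ≠ 0).card) ?_
    (fun i => a i - t * g i) ?_ ?_ rfl
  · rw [← hm]
    apply Finset.card_lt_card
    refine (Finset.ssubset_iff_of_subset ?_).2 ⟨i₀, by simpa using hai₀, ?_⟩
    · intro i
      simp only [Finset.mem_filter, Finset.mem_univ, true_and]
      intro h h'
      apply h
      simp [g, h']
    · simp only [Finset.mem_filter, Finset.mem_univ, true_and, not_not, t]
      field_simp
      ring
  · intro i
    rcases le_or_gt (g i) 0 with h | h
    · have := mul_nonneg ht0 (neg_nonneg.2 h)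
      have := ha i
      linarith
    · have h1 := hmin i h
      rw [le_div_iff₀ h] at h1
      simp only [t]
      linarith
  · simp only [sub_smul, Finset.sum_sub_distrib, hy, mul_smul, ← Finset.smul_sum, hg]
    simp

theorem exists_base_nonneg (ht : E →ₗ[ℝ] ℝ) {q : ℝ} (hq : 0 < q) (hw : ∀ i, ht (w i) = q)
    (hsp : Submodule.span ℝ (Set.range w) = ⊤) (hn : Module.finrank ℝ E = n)
    (a : ι → ℝ) (ha : ∀ i, 0 ≤ a i) :
    ∃ s c, IsBase w n s c ∧ ∀ i, 0 ≤ c i (∑ i, a i • w i) := by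
  obtain ⟨a', ha', hy, hli⟩ := conic_carath (w := w) ht hq hw (∑ i, a i • w i) _ a ha rfl rfl
  have hx := hli.linearIndepOn_extend (Set.subset_univ _)
  have hsub := hli.subset_extend (Set.subset_univ _)
  have hspan := hli.span_image_extend_eq_span_image (Set.subset_univ _)
  rw [Set.image_univ, hsp] at hspan
  set S := hli.extend (Set.subset_univ _) with hS
  classical
  obtain ⟨c, hc⟩ := exists_isBase (w := w) (n := n) S.toFinset (by simpa using hx)
    (by simpa using hspan) hn
  refine ⟨_, c, hc, fun i => ?_⟩
  rw [← hy, map_sum]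
  apply Finset.sum_nonneg
  intro j _
  rw [map_smul, smul_eq_mul]
  by_cases hj : a' j = 0
  · simp [hj]
  have hjS : j ∈ S.toFinset := by
    rw [Set.mem_toFinset]; apply hsub; simpa using hj
  apply mul_nonneg (ha' j)
  by_cases hi : i ∈ S.toFinset
  · rw [hc.dual i hi j hjS]; split_ifs <;> norm_num
  · simp [hc.off i hi]

theorem IsBase.pivot {s : Finset ι} {c : ι → E →ₗ[ℝ] ℝ} (h : IsBase w n s c) {j i₀ : ι}
    (hj : j ∉ s) (hi₀ : i₀ ∈ s) (hk : c i₀ (w j) ≠ 0) :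
    IsBase w n (insert j (s.erase i₀))
      (fun i => c i + ((if i = j then 1 else 0) - c i (w j)) • ((c i₀ (w j))⁻¹ • c i₀)) := by
  have hji : i₀ ≠ j := fun h => hj (h ▸ hi₀)
  refine ⟨?_, ?_, ?_, ?_⟩
  · intro i hi
    simp only [Finset.mem_insert, Finset.mem_erase, not_or, not_and] at hi
    by_cases h1 : i = i₀
    · subst h1
      ext y
      simp [hi.1]
      field_simp
      simp
    · have := h.off i (hi.2 h1)
      simp [this, hi.1]
  · intro y
    have h1 := h.rep y
    have h2 := h.rep (w j)
    simp only [LinearMap.add_apply, LinearMap.smul_apply, smul_eq_mul, add_smul,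
      Finset.sum_add_distrib, h1, mul_comm _ ((c i₀ (w j))⁻¹ * (c i₀) y), mul_smul,
      sub_smul, ← Finset.smul_sum, Finset.sum_sub_distrib, h2]
    simp
  · have hcj := h.off j hj
    intro i hi k hk'
    simp only [Finset.mem_insert, Finset.mem_erase] at hi hk'
    rcases hi with rfl | ⟨hi1, hi2⟩
    · rcases hk' with rfl | ⟨hk1, hk2⟩
      · simp [hcj, hk]
      · have : i ≠ k := fun h => hj (h ▸ hk2)
        simp [hcj, this, h.dual i₀ hi₀ k hk2, hk1.symm]
    · have hij : i ≠ j := fun h => hj (h ▸ hi2)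
      rcases hk' with rfl | ⟨hk1, hk2⟩
      · simp [hij, hk]
      · simp [hij, h.dual i₀ hi₀ k hk2, hk1.symm, h.dual i hi2 k hk2]
  · rw [Finset.card_insert_of_notMem (by simp [hj]), Finset.card_erase_of_mem hi₀]
    have : 0 < s.card := Finset.card_pos.2 ⟨i₀, hi₀⟩
    rw [← h.card]; omega

/-- Half-open simplicial decomposition of the cone spanned by `w`. -/
theorem exists_decomp (ht : E →ₗ[ℝ] ℝ) {q : ℝ} (hq : 0 < q) (hw : ∀ i, ht (w i) = q)
    (hsp : Submodule.span ℝ (Set.range w) = ⊤) (hn : Module.finrank ℝ E = n) :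
    ∃ (T : Finset (Finset ι)) (c : Finset ι → ι → E →ₗ[ℝ] ℝ) (ξ : E),
      (∀ s ∈ T, IsBase w n s (c s)) ∧
      ∀ a : ι → ℝ, (∀ i, 0 ≤ a i) →
        ∃! s, s ∈ T ∧ ∀ i ∈ s, LexPos (c s i (∑ i, a i • w i)) (c s i ξ) := by
  classical
  let Bs := {s : Finset ι // ∃ c, IsBase w n s c}
  let cf : Bs → ι → E →ₗ[ℝ] ℝ := fun B => B.2.choose
  have hcf : ∀ B : Bs, IsBase w n B.1 (cf B) := fun B => B.2.choose_spec
  -- generic direction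
  obtain ⟨x, hx, hxg⟩ := exists_generic
    (fun k : {k : Bs × ι // k.2 ∈ k.1.1} => fun i => cf k.1.1 k.1.2 (w i)) (by
      rintro ⟨⟨B, i⟩, hi⟩ h
      have := congrFun h i
      simp [(hcf B).dual i hi i hi] at this)
  obtain ⟨ω, -, hωg⟩ := exists_generic
    (fun k : {k : Bs × ι // k.2 ∉ k.1.1} => fun i =>
      (if i = k.1.2 then 1 else 0) - cf k.1.1 i (w k.1.2)) (by
      rintro ⟨⟨B, j⟩, hj⟩ h
      have := congrFun h j
      simp [(hcf B).off j hj] at this)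
  let ξ := ∑ i, x i • w i
  have hξ : ∀ (B : Bs) (i), i ∈ B.1 → cf B i ξ ≠ 0 := by
    intro B i hi
    have := hxg ⟨(B, i), hi⟩
    simpa [ξ, map_sum] using this
  let φ : Bs → E →ₗ[ℝ] ℝ := fun B => ∑ i, ω i • cf B i
  have hφ : ∀ B y, φ B y = ∑ i, ω i * cf B i y := by
    intro B y; simp [φ]
  have hφin : ∀ (B : Bs) (j), j ∈ B.1 → φ B (w j) = ω j := by
    intro B j hj
    rw [hφ, Finset.sum_eq_single j]
    · simp [(hcf B).dual j hj j hj]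
    · intro i _ hij
      by_cases hi : i ∈ B.1
      · simp [(hcf B).dual i hi j hj, hij]
      · simp [(hcf B).off i hi]
    · simp
  have hφne : ∀ (B : Bs) (j), j ∉ B.1 → φ B (w j) ≠ ω j := by
    intro B j hj h
    apply hωg ⟨(B, j), hj⟩
    rw [hφ] at h
    simp [mul_sub, Finset.sum_sub_distrib, h]
  let TT : Bs → Prop := fun B => ∀ j, j ∉ B.1 → φ B (w j) < ω j
  let T : Finset (Finset ι) := Finset.univ.filter fun s => ∃ h : (∃ c, IsBase w n s c), TT ⟨s, h⟩
  let c : Finset ι → ι → E →ₗ[ℝ] ℝ := fun s =>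
    if h : (∃ c, IsBase w n s c) then cf ⟨s, h⟩ else 0
  have hc : ∀ B : Bs, c B.1 = cf B := fun B => dif_pos B.2
  refine ⟨T, c, ξ, ?_, ?_⟩
  · intro s hs
    obtain ⟨h, -⟩ := (Finset.mem_filter.1 hs).2
    rw [hc ⟨s, h⟩]
    exact hcf ⟨s, h⟩
  intro a ha
  set y := ∑ i, a i • w i with hy
  obtain ⟨ε, hε, hε0⟩ : ∃ ε : ℝ, (∀ k : {k : Bs × ι // k.2 ∈ k.1.1},
      (0 < cf k.1.1 k.1.2 y + ε * cf k.1.1 k.1.2 ξ ↔ LexPos (cf k.1.1 k.1.2 y) (cf k.1.1 k.1.2 ξ)) ∧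
      cf k.1.1 k.1.2 y + ε * cf k.1.1 k.1.2 ξ ≠ 0) ∧ 0 < ε := by
    have h1 := Filter.eventually_all.2 (fun k : {k : Bs × ι // k.2 ∈ k.1.1} =>
      lexPos_eventually (cf k.1.1 k.1.2 y) (cf k.1.1 k.1.2 ξ) (hξ k.1.1 k.1.2 k.2))
    obtain ⟨ε, h⟩ := (h1.and self_mem_nhdsWithin).exists
    exact ⟨ε, h.1, h.2⟩
  set z := y + ε • ξ with hz
  have hzc : ∀ (B : Bs) i, cf B i z = cf B i y + ε * cf B i ξ := by
    intro B i; simp [hz]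
  have hlex : ∀ (B : Bs) (i), i ∈ B.1 → (0 < cf B i z ↔ LexPos (cf B i y) (cf B i ξ)) := by
    intro B i hi; rw [hzc]; exact (hε ⟨(B, i), hi⟩).1
  have hzne : ∀ (B : Bs) (i), i ∈ B.1 → cf B i z ≠ 0 := by
    intro B i hi; rw [hzc]; exact (hε ⟨(B, i), hi⟩).2
  have hzrep : z = ∑ i, (a i + ε * x i) • w i := by
    simp only [hz, hy, ξ, add_smul, mul_smul, Finset.sum_add_distrib, Finset.smul_sum]
  have hφz : ∀ B B' : Bs, φ B z = ∑ j, cf B' j z * φ B (w j) := by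
    intro B B'
    conv_lhs => rw [← (hcf B').rep z]
    simp [map_sum]
  -- uniqueness
  have huniq : ∀ B B' : Bs, TT B → TT B' → (∀ i ∈ B.1, 0 < cf B i z) →
      (∀ i ∈ B'.1, 0 < cf B' i z) → φ B z ≤ φ B' z ∧ (¬ B'.1 ⊆ B.1 → φ B z < φ B' z) := by
    intro B B' hB hB' hp hp'
    have hle : ∀ j, cf B' j z * φ B (w j) ≤ cf B' j z * ω j := by
      intro j
      by_cases hj : j ∈ B'.1
      · apply mul_le_mul_of_nonneg_left _ (hp' j hj).le
        by_cases hjB : j ∈ B.1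
        · exact (hφin B j hjB).le
        · exact (hB j hjB).le
      · simp [(hcf B').off j hj]
    have e' : φ B' z = ∑ j, cf B' j z * ω j := by
      rw [hφ]; exact Finset.sum_congr rfl fun i _ => mul_comm _ _
    rw [hφz B B', e']
    refine ⟨Finset.sum_le_sum fun j _ => hle j, fun hns => ?_⟩
    obtain ⟨j, hj, hjB⟩ := Finset.not_subset.1 hns
    exact Finset.sum_lt_sum (fun j _ => hle j)
      ⟨j, Finset.mem_univ _, mul_lt_mul_of_pos_left (hB j hjB) (hp' j hj)⟩
  -- existence
  have hex : ∃ B : Bs, TT B ∧ ∀ i ∈ B.1, 0 < cf B i z := by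
    obtain ⟨s₀, c₀, hb₀, hnn⟩ := exists_base_nonneg (w := w) ht hq hw hsp hn
      (fun i => a i + ε * x i) (fun i => add_nonneg (ha i) (mul_nonneg hε0.le (hx i).le))
    rw [← hzrep] at hnn
    obtain ⟨B, hB, hmin⟩ := Set.exists_min_image {B : Bs | ∀ i, 0 ≤ cf B i z} (fun B => φ B z)
      (Set.toFinite _) ⟨⟨s₀, c₀, hb₀⟩, by
        have : cf ⟨s₀, c₀, hb₀⟩ = c₀ := (hcf ⟨s₀, c₀, hb₀⟩).unique hb₀
        simpa [this] using hnn⟩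
    have hpos : ∀ i ∈ B.1, 0 < cf B i z := fun i hi => lt_of_le_of_ne (hB i) (hzne B i hi).symm
    refine ⟨B, ?_, hpos⟩
    intro j hj
    by_contra hcon
    have hlt : ω j < φ B (w j) := lt_of_le_of_ne (not_lt.1 hcon) (hφne B j hj).symm
    have hsum : ∑ i, cf B i (w j) = 1 := by
      have h1 := congrArg ht ((hcf B).rep (w j))
      simp only [map_sum, map_smul, hw, smul_eq_mul] at h1
      rw [← Finset.sum_mul] at h1
      exact mul_right_cancel₀ hq.ne' (by rw [h1, one_mul])
    have hp : ∃ i, 0 < cf B i (w j) := by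
      by_contra hno
      push Not at hno
      have := Finset.sum_nonpos (fun i (_ : i ∈ Finset.univ) => hno i)
      linarith
    obtain ⟨i₁, hi₁⟩ := hp
    obtain ⟨i₀, hi₀, hmi⟩ := Finset.exists_min_image (Finset.univ.filter fun i => 0 < cf B i (w j))
      (fun i => cf B i z / cf B i (w j)) ⟨i₁, by simpa using hi₁⟩
    simp only [Finset.mem_filter, Finset.mem_univ, true_and] at hi₀ hmi
    have hi₀B : i₀ ∈ B.1 := by
      by_contra h; simp [(hcf B).off i₀ h] at hi₀
    have hpiv := (hcf B).pivot hj hi₀B hi₀.ne'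
    let B' : Bs := ⟨_, _, hpiv⟩
    have hB'c := (hcf B').unique hpiv
    set t := (cf B i₀ (w j))⁻¹ * cf B i₀ z with htdef
    have htpos : 0 < t := mul_pos (inv_pos.2 hi₀) (hpos i₀ hi₀B)
    have hB'z : ∀ i, cf B' i z = cf B i z + ((if i = j then 1 else 0) - cf B i (w j)) * t := by
      intro i; rw [hB'c]; simp [htdef]
    have hmem : ∀ i, 0 ≤ cf B' i z := by
      intro i
      rw [hB'z]
      have hbi := hB i
      have h3 : 0 ≤ cf B i z - cf B i (w j) * t := by
        rcases le_or_gt (cf B i (w j)) 0 with h | h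
        · nlinarith
        · have h1 := hmi i h
          rw [le_div_iff₀ h] at h1
          rw [htdef, inv_mul_eq_div]
          linarith
      split_ifs
      · linarith
      · linarith
    have h5 := hmin B' hmem
    have h6 : φ B' z = φ B z + (ω j - φ B (w j)) * t := by
      rw [hφ, hφ, hφ]
      simp only [hB'z, mul_add, sub_mul, mul_sub, Finset.sum_add_distrib, Finset.sum_sub_distrib,
        Finset.sum_mul]
      simp [mul_assoc]
    have : (ω j - φ B (w j)) * t < 0 := mul_neg_of_neg_of_pos (by linarith) htpos
    linarith
  obtain ⟨B, hBT, hBp⟩ := hex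
  refine ⟨B.1, ⟨Finset.mem_filter.2 ⟨Finset.mem_univ _, B.2, hBT⟩, fun i hi => ?_⟩, ?_⟩
  · rw [hc]; exact (hlex B i hi).1 (hBp i hi)
  · rintro s ⟨hs, hsl⟩
    obtain ⟨h, hT⟩ := (Finset.mem_filter.1 hs).2
    let B' : Bs := ⟨s, h⟩
    have hB'p : ∀ i ∈ B'.1, 0 < cf B' i z := by
      intro i hi
      have := hsl i hi
      rw [hc B'] at this
      exact (hlex B' i hi).2 this
    have u1 := huniq B B' hBT hT hBp hB'p
    have u2 := huniq B' B hT hBT hB'p hBp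
    apply Finset.Subset.antisymm
    · by_contra hcon
      exact absurd (u1.2 hcon) (not_lt.2 u2.1)
    · by_contra hcon
      exact absurd (u2.2 hcon) (not_lt.2 u1.1)

end tri

section series
variable {F : Type*} [AddCommGroup F] [Module ℝ F]

/-- Graded counting series. -/
noncomputable def gs (deg : F →ₗ[ℝ] ℝ) (S : Set F) : PowerSeries ℤ :=
  PowerSeries.mk fun k => (Set.ncard {y | y ∈ S ∧ deg y = (k : ℝ)} : ℤ)

theorem gs_shift (deg : F →ₗ[ℝ] ℝ) (S : Set F) (v : F) (q : ℕ) (hv : deg v = q)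
    (hS : ∀ y ∈ S, y + v ∈ S) (hfin : ∀ k : ℕ, {y | y ∈ S ∧ deg y = (k : ℝ)}.Finite)
    (hnn : ∀ y ∈ S, 0 ≤ deg y) :
    (1 - PowerSeries.X ^ q) * gs deg S = gs deg {y | y ∈ S ∧ y - v ∉ S} := by
  ext k
  rw [sub_mul, one_mul, map_sub, PowerSeries.coeff_X_pow_mul']
  simp only [gs, PowerSeries.coeff_mk]
  split_ifs with hk
  · have hU : {y | y ∈ S ∧ deg y = (k : ℝ)} =
        {y | y ∈ {y | y ∈ S ∧ y - v ∉ S} ∧ deg y = (k : ℝ)} ∪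
          (fun y => y + v) '' {y | y ∈ S ∧ deg y = ((k - q : ℕ) : ℝ)} := by
      ext y
      constructor
      · rintro ⟨h1, h2⟩
        by_cases h : y - v ∈ S
        · right
          refine ⟨y - v, ⟨h, ?_⟩, by simp⟩
          rw [map_sub, h2, hv]; push_cast [hk]; ring
        · exact Or.inl ⟨⟨h1, h⟩, h2⟩
      · rintro (⟨⟨h1, _⟩, h2⟩ | ⟨z, ⟨h1, h2⟩, rfl⟩)
        · exact ⟨h1, h2⟩
        · refine ⟨hS z h1, ?_⟩
          rw [map_add, h2, hv]; push_cast [hk]; ring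
    have hinj : Function.Injective (fun y : F => y + v) := add_left_injective v
    rw [hU, Set.ncard_union_eq ?_ ?_ ?_, Set.ncard_image_of_injective _ hinj]
    · push_cast; ring
    · rw [Set.disjoint_left]
      rintro _ ⟨⟨_, h⟩, _⟩ ⟨z, ⟨h1, _⟩, rfl⟩
      apply h
      simpa using h1
    · exact (hfin k).subset fun y hy => ⟨hy.1.1, hy.2⟩
    · exact (hfin _).image _
  · rw [sub_zero]
    congr 2
    ext y
    constructor
    · rintro ⟨h1, h2⟩
      refine ⟨⟨h1, fun h => ?_⟩, h2⟩
      have := hnn _ h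
      rw [map_sub, h2, hv] at this
      have h3 : (k : ℝ) < q := by exact_mod_cast not_le.1 hk
      linarith
    · rintro ⟨⟨h1, _⟩, h2⟩
      exact ⟨h1, h2⟩

theorem gs_poly (deg : F →ₗ[ℝ] ℝ) (S : Set F) (R : ℝ) (hR : ∀ y ∈ S, deg y ≤ R) :
    ∃ h : Polynomial ℤ, (h : PowerSeries ℤ) = gs deg S ∧ ∀ i, 0 ≤ h.coeff i := by
  obtain ⟨N, hN⟩ := exists_nat_gt R
  have key : ((gs deg S).trunc N : PowerSeries ℤ) = gs deg S := by
    ext k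
    rw [Polynomial.coeff_coe, PowerSeries.coeff_trunc]
    split_ifs with hk
    · rfl
    · simp only [gs, PowerSeries.coeff_mk]
      have : {y | y ∈ S ∧ deg y = (k : ℝ)} = ∅ := by
        ext y
        simp only [Set.mem_ofPred_eq, Set.mem_empty_iff_false, iff_false, not_and]
        intro h1 h2
        have := hR y h1
        have h3 : (N : ℝ) ≤ k := by exact_mod_cast not_lt.1 hk
        linarith
      rw [this]; simp
  refine ⟨_, key, fun i => ?_⟩
  rw [← Polynomial.coeff_coe, key]
  simp [gs]

variable {ι E : Type*} [Fintype ι] [DecidableEq ι] [AddCommGroup E] [Module ℝ E]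
  {w : ι → E} {n : ℕ}

theorem box_series {s : Finset ι} {c : ι → E →ₗ[ℝ] ℝ} (hB : IsBase w n s c) (ξ : E) (q : ℕ)
    (pr : F →ₗ[ℝ] E) (deg : F →ₗ[ℝ] ℝ) (g : ι → F) (hg : ∀ i, pr (g i) = w i)
    (hdg : ∀ i, deg (g i) = q) (L : Set F) (hL : ∀ y i, y + g i ∈ L ↔ y ∈ L)
    (hfin : ∀ k : ℕ, {y | (y ∈ L ∧ ∀ i ∈ s, LexPos (c i (pr y)) (c i ξ)) ∧ deg y = (k : ℝ)}.Finite)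
    (hnn : ∀ y ∈ L, (∀ i ∈ s, LexPos (c i (pr y)) (c i ξ)) → 0 ≤ deg y)
    (A : Finset ι) (hA : A ⊆ s) :
    (1 - PowerSeries.X ^ q) ^ A.card *
        gs deg {y | y ∈ L ∧ ∀ i ∈ s, LexPos (c i (pr y)) (c i ξ)} =
      gs deg {y | (y ∈ L ∧ ∀ i ∈ s, LexPos (c i (pr y)) (c i ξ)) ∧
        ∀ i ∈ A, ¬ LexPos (c i (pr y) - 1) (c i ξ)} := by
  induction A using Finset.induction_on with
  | empty => simp
  | insert j A hj ih =>
    have hjs : j ∈ s := hA (Finset.mem_insert_self _ _)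
    have hAs : A ⊆ s := fun i hi => hA (Finset.mem_insert_of_mem hi)
    have hcw : ∀ i ∈ s, c i (w j) = if i = j then 1 else 0 := fun i hi => hB.dual i hi j hjs
    rw [Finset.card_insert_of_notMem hj, pow_succ', mul_assoc, ih hAs,
      gs_shift deg _ (g j) q (hdg j)]
    · congr 1
      ext y
      simp only [Set.mem_ofPred_eq, Finset.mem_insert, forall_eq_or_imp, map_sub, hg]
      have hLy : y - g j ∈ L ↔ y ∈ L := by
        rw [← hL (y - g j) j, sub_add_cancel]
      rw [hLy]
      constructor
      · rintro ⟨⟨⟨h1, h2⟩, h3⟩, h4⟩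
        refine ⟨⟨h1, h2⟩, fun h5 => h4 ⟨⟨h1, fun i hi => ?_⟩, fun i hi => ?_⟩, h3⟩
        · rw [hcw i hi]
          split_ifs with h
          · rw [h]; exact h5
          · rw [sub_zero]; exact h2 i hi
        · rw [hcw i (hAs hi), if_neg (fun h : i = j => hj (h ▸ hi)), sub_zero]
          exact h3 i hi
      · rintro ⟨⟨h1, h2⟩, h3, h4⟩
        refine ⟨⟨⟨h1, h2⟩, h4⟩, fun h5 => h3 ?_⟩
        have := h5.1.2 j hjs
        rwa [hcw j hjs, if_pos rfl] at this
    · rintro y ⟨⟨h1, h2⟩, h3⟩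
      refine ⟨⟨(hL y j).2 h1, fun i hi => ?_⟩, fun i hi => ?_⟩
      · rw [map_add, map_add, hg, hcw i hi]
        have := h2 i hi
        split_ifs
        · left
          rcases this with h | h
          · linarith
          · linarith [h.1]
        · rwa [add_zero]
      · rw [map_add, map_add, hg, hcw i (hAs hi), if_neg (fun h : i = j => hj (h ▸ hi)), add_zero]
        exact h3 i hi
    · intro k
      exact (hfin k).subset fun y hy => ⟨hy.1.1, hy.2⟩
    · rintro y ⟨⟨h1, h2⟩, _⟩
      exact hnn y h1 h2

theorem cone_series (ht : E →ₗ[ℝ] ℝ) {q : ℕ} (hq : 0 < q) (hw : ∀ i, ht (w i) = q)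
    (hsp : Submodule.span ℝ (Set.range w) = ⊤) (hn : Module.finrank ℝ E = n)
    (pr : F →ₗ[ℝ] E) (deg : F →ₗ[ℝ] ℝ) (g : ι → F) (hg : ∀ i, pr (g i) = w i)
    (hdg : ∀ i, deg (g i) = q) (L : Set F) (hL : ∀ y i, y + g i ∈ L ↔ y ∈ L)
    (R : ℝ) (hR : ∀ y ∈ L, deg y ≤ ht (pr y) + R)
    (C : Set E) (hC : ∀ y, y ∈ C ↔ ∃ a : ι → ℝ, (∀ i, 0 ≤ a i) ∧ ∑ i, a i • w i = y)
    (hfin : ∀ k : ℕ, {y | (y ∈ L ∧ pr y ∈ C) ∧ deg y = (k : ℝ)}.Finite)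
    (hnn : ∀ y ∈ L, pr y ∈ C → 0 ≤ deg y) :
    ∃ h : Polynomial ℤ, (h : PowerSeries ℤ) =
      (1 - PowerSeries.X ^ q) ^ n * gs deg {y | y ∈ L ∧ pr y ∈ C} ∧ ∀ i, 0 ≤ h.coeff i := by
  classical
  have hq' : (0 : ℝ) < q := by exact_mod_cast hq
  obtain ⟨T, c, ξ, hT, huniq⟩ := exists_decomp (w := w) (n := n) ht hq' hw hsp hn
  have hHC : ∀ s ∈ T, ∀ y, (∀ i ∈ s, LexPos (c s i y) (c s i ξ)) → y ∈ C := by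
    intro s hs y hy
    refine (hC y).2 ⟨fun i => c s i y, fun i => ?_, (hT s hs).rep y⟩
    by_cases hi : i ∈ s
    · rcases hy i hi with h | h
      · exact h.le
      · exact h.1.ge
    · simp [(hT s hs).off i hi]
  have hCu : ∀ y ∈ C, ∃! s, s ∈ T ∧ ∀ i ∈ s, LexPos (c s i y) (c s i ξ) := by
    intro y hy
    obtain ⟨a, ha, rfl⟩ := (hC y).1 hy
    exact huniq a ha
  have hsum : gs deg {y | y ∈ L ∧ pr y ∈ C} =
      ∑ s ∈ T, gs deg {y | y ∈ L ∧ ∀ i ∈ s, LexPos (c s i (pr y)) (c s i ξ)} := by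
    ext k
    rw [map_sum]
    simp only [gs, PowerSeries.coeff_mk]
    let f : F → Finset ι := fun y => if h : pr y ∈ C then (hCu _ h).choose else ∅
    have hf : ∀ y, pr y ∈ C → (f y ∈ T ∧ ∀ i ∈ f y, LexPos (c (f y) i (pr y)) (c (f y) i ξ)) := by
      intro y hy
      simp only [f, dif_pos hy]
      exact (hCu _ hy).choose_spec.1
    have hf' : ∀ y, pr y ∈ C → ∀ s ∈ T, (∀ i ∈ s, LexPos (c s i (pr y)) (c s i ξ)) → f y = s := by
      intro y hy s hs h
      exact (hCu _ hy).unique (hf y hy) ⟨hs, h⟩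
    have h1 := Finset.card_eq_sum_card_fiberwise (f := f) (s := (hfin k).toFinset) (t := T) (by
      intro y hy
      have hy := (Set.Finite.mem_toFinset _).1 hy
      exact (hf y hy.1.2).1)
    have h0 : Set.ncard {y | y ∈ {y | y ∈ L ∧ pr y ∈ C} ∧ deg y = (k : ℝ)} =
        (hfin k).toFinset.card := Set.ncard_eq_toFinset_card _ (hfin k)
    rw [h0, h1]
    push_cast
    refine Finset.sum_congr rfl fun s hs => ?_
    rw [← Set.ncard_coe_finset]
    congr 2
    ext y
    simp only [Finset.coe_filter, Set.Finite.mem_toFinset, Set.mem_ofPred_eq]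
    constructor
    · rintro ⟨⟨⟨h1, h2⟩, h3⟩, rfl⟩
      exact ⟨⟨h1, (hf y h2).2⟩, h3⟩
    · rintro ⟨⟨h1, h2⟩, h3⟩
      have := hHC s hs _ h2
      exact ⟨⟨⟨h1, this⟩, h3⟩, hf' y this s hs h2⟩
  have hpoly : ∀ s ∈ T, ∃ h : Polynomial ℤ, (h : PowerSeries ℤ) =
      (1 - PowerSeries.X ^ q) ^ n *
        gs deg {y | y ∈ L ∧ ∀ i ∈ s, LexPos (c s i (pr y)) (c s i ξ)} ∧ ∀ i, 0 ≤ h.coeff i := by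
    intro s hs
    have hb := box_series (hT s hs) ξ q pr deg g hg hdg L hL
      (fun k => (hfin k).subset fun y hy => ⟨⟨hy.1.1, hHC s hs _ hy.1.2⟩, hy.2⟩)
      (fun y hy h => hnn y hy (hHC s hs _ h)) s (Finset.Subset.refl s)
    rw [(hT s hs).card] at hb
    rw [hb]
    refine gs_poly deg _ ((Fintype.card ι : ℝ) * q + R) ?_
    rintro y ⟨⟨h1, h2⟩, h3⟩
    refine (hR y h1).trans ?_
    have h4 : ht (pr y) = ∑ i, c s i (pr y) * q := by
      conv_lhs => rw [← (hT s hs).rep (pr y)]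
      simp [map_sum, hw]
    have h5 : ∑ i, c s i (pr y) * (q : ℝ) ≤ ∑ _i : ι, (q : ℝ) := by
      refine Finset.sum_le_sum fun i _ => ?_
      have : c s i (pr y) ≤ 1 := by
        by_cases hi : i ∈ s
        · by_contra hcon
          exact h3 i hi (Or.inl (by linarith))
        · simp [(hT s hs).off i hi]
      nlinarith
    rw [h4]
    simp only [Finset.sum_const, Finset.card_univ, nsmul_eq_mul] at h5
    linarith
  choose! p hp hp0 using hpoly
  refine ⟨∑ s ∈ T, p s, ?_, fun i => ?_⟩
  · rw [hsum, Finset.mul_sum, ← Polynomial.coeToPowerSeries.ringHom_apply, map_sum]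
    exact Finset.sum_congr rfl fun s hs => hp s hs
  · rw [Polynomial.finsetSum_coeff]
    exact Finset.sum_nonneg fun s hs => hp0 s hs i

end series

section geom

theorem gs_add {F : Type*} [AddCommGroup F] [Module ℝ F] (deg : F →ₗ[ℝ] ℝ) (S A B : Set F)
    (hS : S = A ∪ B) (hd : Disjoint A B)
    (hfin : ∀ k : ℕ, {y | y ∈ S ∧ deg y = (k : ℝ)}.Finite) :
    gs deg S = gs deg A + gs deg B := by
  subst hS
  ext k
  rw [map_add]
  simp only [gs, PowerSeries.coeff_mk]
  have : {y | y ∈ A ∪ B ∧ deg y = (k : ℝ)} =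
      {y | y ∈ A ∧ deg y = (k : ℝ)} ∪ {y | y ∈ B ∧ deg y = (k : ℝ)} := by
    ext y
    simp only [Set.mem_union, Set.mem_ofPred_eq]
    tauto
  rw [this, Set.ncard_union_eq ?_ ?_ ?_]
  · push_cast; rfl
  · exact hd.mono (fun y hy => hy.1) (fun y hy => hy.1)
  · exact (hfin k).subset fun y hy => ⟨Or.inl hy.1, hy.2⟩
  · exact (hfin k).subset fun y hy => ⟨Or.inr hy.1, hy.2⟩

theorem lattice_finite {m : ℕ} (S : Set (Fin m → ℝ)) (hS : Bornology.IsBounded S) :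
    {x ∈ S | IsLatticePt x}.Finite := by
  obtain ⟨R, hR⟩ := hS.exists_norm_le
  obtain ⟨N, hN⟩ := exists_nat_ge R
  have hf : (Set.Icc (fun _ => -(N : ℤ)) (fun _ => (N : ℤ)) : Set (Fin m → ℤ)).Finite :=
    Set.finite_Icc _ _
  refine (hf.image (fun a i => ((a i : ℤ) : ℝ))).subset ?_
  rintro x ⟨hx, hl⟩
  choose a ha using hl
  refine ⟨a, ⟨fun i => ?_, fun i => ?_⟩, funext fun i => (ha i).symm⟩
  all_goals
    have h1 := (norm_le_pi_norm x i).trans ((hR x hx).trans hN)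
    rw [ha i, Real.norm_eq_abs, abs_le] at h1
  · exact_mod_cast h1.1
  · exact_mod_cast h1.2

theorem ehr_coeff {m : ℕ} (S : Set (Fin m → ℝ)) (hS : S.Nonempty) (k : ℕ) :
    PowerSeries.coeff k (ehrSeries S) = (latCount ((k : ℝ) • S) : ℤ) := by
  simp only [ehrSeries, PowerSeries.coeff_mk]
  split_ifs with h
  · subst h
    rw [Nat.cast_zero, Set.zero_smul_set hS]
    have : {x ∈ (0 : Set (Fin m → ℝ)) | IsLatticePt x} = {0} := by
      ext x
      simp only [Set.mem_zero, Set.mem_ofPred_eq, Set.mem_singleton_iff, and_iff_left_iff_imp]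
      rintro rfl i
      exact ⟨0, by simp⟩
    rw [latCount, this]; simp
  · rfl

variable {d : ℕ}

/-- Cone over `P`. -/
def coneOf (P : Set (Fin d → ℝ)) : Set ((Fin d → ℝ) × ℝ) := {z | 0 ≤ z.2 ∧ z.1 ∈ z.2 • P}

theorem mem_coneOf (P : Set (Fin d → ℝ)) (hP : P.Nonempty) {q : ℕ} (hq : 0 < q)
    (V : Finset (Fin d → ℝ)) (hV : (q : ℝ) • P = convexHull ℝ (V : Set (Fin d → ℝ)))
    (z : (Fin d → ℝ) × ℝ) :
    z ∈ coneOf P ↔ ∃ a : V → ℝ, (∀ i, 0 ≤ a i) ∧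
      ∑ i, a i • ((i : Fin d → ℝ), (q : ℝ)) = z := by
  have hq' : (0 : ℝ) < q := by exact_mod_cast hq
  obtain ⟨y, h⟩ := z
  have hsum : ∀ a : V → ℝ, ∑ i, a i • ((i : Fin d → ℝ), (q : ℝ)) =
      (∑ i, a i • (i : Fin d → ℝ), (∑ i, a i) * q) := by
    intro a
    ext1
    · simp [Prod.fst_sum]
    · simp [Prod.snd_sum, Finset.sum_mul]
  simp only [hsum, Prod.mk.injEq]
  constructor
  · rintro ⟨h0, p, hp, hpy⟩
    simp only at h0 hpy
    have hm : (q : ℝ) • p ∈ convexHull ℝ (V : Set (Fin d → ℝ)) := hV ▸ Set.smul_mem_smul_set hp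
    obtain ⟨b, hb, hb1, hb2⟩ := Finset.mem_convexHull'.1 hm
    rw [← Finset.sum_coe_sort] at hb1 hb2
    refine ⟨fun i => h / q * b i, fun i => mul_nonneg (div_nonneg h0 hq'.le) (hb i i.2), ?_, ?_⟩
    · simp only [mul_smul, ← Finset.smul_sum]
      rw [hb2, smul_smul, div_mul_cancel₀ _ hq'.ne', ← hpy]
    · rw [← Finset.mul_sum, hb1]; field_simp
  · rintro ⟨a, ha, h1, h2⟩
    have hA : 0 ≤ ∑ i, a i := Finset.sum_nonneg fun i _ => ha i
    refine ⟨by simp only [← h2]; positivity, ?_⟩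
    simp only
    rcases hA.eq_or_lt with h0 | h0
    · have ha0 := (Finset.sum_eq_zero_iff_of_nonneg (fun i _ => ha i)).1 h0.symm
      have hy : y = 0 := by
        rw [← h1]
        exact Finset.sum_eq_zero fun i hi => by rw [ha0 i hi, zero_smul]
      rw [← h2, ← h0, zero_mul, Set.zero_smul_set hP, hy]
      rfl
    · have hm : (∑ i, a i)⁻¹ • y ∈ convexHull ℝ (V : Set (Fin d → ℝ)) := by
        rw [← h1, Finset.smul_sum]
        simp only [smul_smul]
        refine (convex_convexHull ℝ _).sum_mem (fun i _ => ?_) ?_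
          (fun i _ => subset_convexHull ℝ _ i.2)
        · exact mul_nonneg (inv_nonneg.2 hA) (ha i)
        · rw [← Finset.mul_sum, inv_mul_cancel₀ h0.ne']
      rw [← hV] at hm
      obtain ⟨p, hp, hpy⟩ := hm
      refine ⟨p, hp, ?_⟩
      simp only at hpy ⊢
      rw [← h2, mul_smul, hpy, smul_smul, mul_inv_cancel₀ h0.ne', one_smul]

theorem span_top (P : Set (Fin d → ℝ)) (hfull : IsFullDim P)
    (U : Submodule ℝ ((Fin d → ℝ) × ℝ)) (hU : coneOf P ⊆ U) : U = ⊤ := by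
  obtain ⟨p, hp⟩ := hfull
  have hP : ∀ y ∈ P, (y, (1 : ℝ)) ∈ U := fun y hy => hU ⟨zero_le_one, by simpa using hy⟩
  have hp1 := hP p (interior_subset hp)
  have hu : ∀ u : Fin d → ℝ, (u, (0 : ℝ)) ∈ U := by
    intro u
    have hc : Filter.Tendsto (fun e : ℝ => p + e • u) (nhdsWithin 0 {0}ᶜ) (nhds p) := by
      have : Continuous (fun e : ℝ => p + e • u) := by fun_prop
      have h := this.tendsto 0
      simp only [zero_smul, add_zero] at h
      exact h.mono_left nhdsWithin_le_nhds
    obtain ⟨e, he, he0⟩ :=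
      ((hc.eventually (isOpen_interior.mem_nhds hp)).and self_mem_nhdsWithin).exists
    have he0 : e ≠ 0 := he0
    have h1 := U.smul_mem e⁻¹ (U.sub_mem (hP _ (interior_subset he)) hp1)
    convert h1 using 1
    ext1
    · simp [smul_smul, he0]
    · simp
  rw [eq_top_iff]
  rintro ⟨u, t⟩ -
  have h1 := U.add_mem (hu (u - t • p)) (U.smul_mem t hp1)
  convert h1 using 1
  ext1
  · simp
  · simp

/-- Coefficient of the apex direction. -/
noncomputable def sl (x : Fin (d + 1) → ℝ) : ((Fin (d + 1) → ℝ) × ℝ) →ₗ[ℝ] ℝ :=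
  (x (Fin.last d))⁻¹ • ((LinearMap.proj (Fin.last d)).comp (LinearMap.fst ℝ _ _))

theorem sl_apply (x : Fin (d + 1) → ℝ) (y) : sl x y = (x (Fin.last d))⁻¹ * y.1 (Fin.last d) := rfl

/-- Projection along the apex direction. -/
noncomputable def prj (x : Fin (d + 1) → ℝ) :
    ((Fin (d + 1) → ℝ) × ℝ) →ₗ[ℝ] ((Fin d → ℝ) × ℝ) where
  toFun y := (fun i => y.1 i.castSucc - sl x y * x i.castSucc, y.2 - sl x y)
  map_add' y z := by
    ext1
    · funext i; simp; ring
    · simp; ring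
  map_smul' c y := by
    ext1
    · funext i; simp; ring
    · simp; ring

theorem prj_apply (x : Fin (d + 1) → ℝ) (y) :
    prj x y = (fun i => y.1 i.castSucc - sl x y * x i.castSucc, y.2 - sl x y) := rfl

/-- The pyramid. -/
def pyr (P : Set (Fin d → ℝ)) (x : Fin (d + 1) → ℝ) : Set (Fin (d + 1) → ℝ) :=
  convexHull ℝ (((fun y : Fin d → ℝ => (Fin.snoc y 0 : Fin (d + 1) → ℝ)) '' P) ∪ {x})

theorem convex_emb (P : Set (Fin d → ℝ)) (hP : Convex ℝ P) :
    Convex ℝ ((fun y : Fin d → ℝ => (Fin.snoc y 0 : Fin (d + 1) → ℝ)) '' P) := by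
  refine hP.is_linear_image ⟨fun a b => ?_, fun c a => ?_⟩
  · funext i; refine Fin.lastCases ?_ (fun i => ?_) i <;> simp
  · funext i; refine Fin.lastCases ?_ (fun i => ?_) i <;> simp

theorem mem_pyr (P : Set (Fin d → ℝ)) (hP : P.Nonempty) (hPc : Convex ℝ P)
    (x : Fin (d + 1) → ℝ) (hx : x (Fin.last d) ≠ 0) (k : ℝ) (hk : 0 ≤ k) (m : Fin (d + 1) → ℝ) :
    m ∈ k • pyr P x ↔ 0 ≤ sl x (m, k) ∧ prj x (m, k) ∈ coneOf P := by
  have hpyr : ∀ u, u ∈ pyr P x ↔ ∃ p ∈ P, ∃ a b : ℝ, 0 ≤ a ∧ 0 ≤ b ∧ a + b = 1 ∧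
      a • x + b • (Fin.snoc p 0 : Fin (d + 1) → ℝ) = u := by
    intro u
    rw [pyr, Set.union_singleton, convexHull_insert (hP.image _), (convex_emb P hPc).convexHull_eq]
    simp only [convexJoin, Set.mem_iUnion, Set.mem_singleton_iff, Set.mem_image, segment,
      Set.mem_ofPred_eq, exists_prop]
    constructor
    · rintro ⟨_, rfl, _, ⟨p, hp, rfl⟩, a, b, h⟩
      exact ⟨p, hp, a, b, h⟩
    · rintro ⟨p, hp, a, b, h⟩
      exact ⟨x, rfl, _, ⟨p, hp, rfl⟩, a, b, h⟩
  constructor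
  · rintro ⟨u, hu, rfl⟩
    obtain ⟨p, hp, a, b, ha, hb, hab, rfl⟩ := (hpyr u).1 hu
    have hs : sl x (k • (a • x + b • (Fin.snoc p 0 : Fin (d + 1) → ℝ)), k) = k * a := by
      rw [sl_apply]
      simp
      field_simp
    refine ⟨?_, ?_⟩
    · simp only; rw [hs]; positivity
    · simp only
      rw [prj_apply, hs]
      have hkb : k - k * a = k * b := by
                                        have hb' : b = 1 - a := by linarith
                                        rw [hb']; ring
      refine ⟨?_, ?_⟩
      · simp only [hkb]; positivity
      · simp only [hkb]
        refine ⟨p, hp, ?_⟩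
        funext i
        simp
        ring
  · rintro ⟨h1, h2, p, hp, hpm⟩
    rw [prj_apply] at h2 hpm
    simp only at h2 hpm
    set s := sl x (m, k) with hs
    have hlast : m (Fin.last d) = s * x (Fin.last d) := by
      rw [hs, sl_apply]; field_simp
    have hm : m = s • x + (k - s) • (Fin.snoc p 0 : Fin (d + 1) → ℝ) := by
      funext i
      refine Fin.lastCases ?_ (fun i => ?_) i
      · simp [hlast]
      · have := congrFun hpm i
        simp at this ⊢
        linarith
    rcases hk.eq_or_lt with h0 | h0
    · subst h0
      have hs0 : s = 0 := by linarith
      have : (pyr P x).Nonempty := ⟨x, subset_convexHull ℝ _ (Or.inr rfl)⟩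
      rw [Set.zero_smul_set this, hm, hs0]
      simp
    · refine ⟨k⁻¹ • m, (hpyr _).2 ⟨p, hp, s / k, (k - s) / k, by positivity, by positivity,
        by field_simp; ring, ?_⟩, by simp [smul_smul, h0.ne']⟩
      conv_rhs => rw [hm]
      rw [smul_add, smul_smul, smul_smul, div_eq_inv_mul, div_eq_inv_mul]

end geom

end PyrAux

/-- **Statement 11.** (Rational-apex pyramids increase the h*-polynomial.) Let `P ⊆ ℝ^d` be
a full-dimensional rational polytope with denominator `q`, embedded in `ℝ^{d+1}` by
appending a last coordinate `0`, let `r > 0` and let `x ∈ (1/r)ℤ^{d+1}` not lie in the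
hyperplane spanned by `P` (i.e. its last coordinate is nonzero).  Then
`h*_P(z) = (1−z^q)^{d+1} Ehr_P(z)` and
`h*_{Pyr(x,P)}(z) = (1−z^q)^{d+1}(1−z^r) Ehr_{Pyr(x,P)}(z)` are polynomials and
`h*_P(z) ≤ h*_{Pyr(x,P)}(z)` coefficient-wise. -/
theorem pyramid_hstar_le {d q r : ℕ} (P : Set (Fin d → ℝ))
    (hrat : IsRationalPolytope P) (hfull : IsFullDim P) (hq : IsDenominator P q)
    (hr : 0 < r) (x : Fin (d + 1) → ℝ)
    (hxr : ∀ i, ∃ a : ℤ, (r : ℝ) * x i = (a : ℝ))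
    (hxo : x (Fin.last d) ≠ 0) :
    ∃ hP hPyr : Polynomial ℤ,
      (hP : PowerSeries ℤ) = (1 - PowerSeries.X ^ q) ^ (d + 1) * ehrSeries P ∧
      (hPyr : PowerSeries ℤ) =
        (1 - PowerSeries.X ^ q) ^ (d + 1) * (1 - PowerSeries.X ^ r) *
          ehrSeries (convexHull ℝ
            (((fun y : Fin d → ℝ => (Fin.snoc y 0 : Fin (d + 1) → ℝ)) '' P) ∪ {x})) ∧
      ∀ i, hP.coeff i ≤ hPyr.coeff i := by
  classical
  obtain ⟨V₀, -, hV₀⟩ := hrat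
  obtain ⟨hq0, ⟨V, hVl, hV⟩, -⟩ := hq
  have hq' : (0 : ℝ) < q := by exact_mod_cast hq0
  have hr' : (0 : ℝ) < r := by exact_mod_cast hr
  have hPne : P.Nonempty := hfull.mono interior_subset
  have hPc : Convex ℝ P := hV₀ ▸ convex_convexHull ℝ _
  have hPcomp : IsCompact P := by
    rw [hV₀]
    exact V₀.finite_toSet.isCompact_convexHull ℝ
  change ∃ hP hPyr : Polynomial ℤ,
      (hP : PowerSeries ℤ) = (1 - PowerSeries.X ^ q) ^ (d + 1) * ehrSeries P ∧
      (hPyr : PowerSeries ℤ) =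
        (1 - PowerSeries.X ^ q) ^ (d + 1) * (1 - PowerSeries.X ^ r) *
          ehrSeries (PyrAux.pyr P x) ∧
      ∀ i, hP.coeff i ≤ hPyr.coeff i
  have hpyrb : Bornology.IsBounded (PyrAux.pyr P x) := by
    rw [PyrAux.pyr, isBounded_convexHull]
    refine Bornology.IsBounded.union ?_ Bornology.isBounded_singleton
    refine (hPcomp.image ?_).isBounded
    refine continuous_pi fun i => ?_
    refine Fin.lastCases ?_ (fun i => ?_) i
    · simp only [Fin.snoc_last]; fun_prop
    · simp only [Fin.snoc_castSucc]; fun_prop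
  have hpyrne : (PyrAux.pyr P x).Nonempty := ⟨x, subset_convexHull ℝ _ (Or.inr rfl)⟩
  let deg : ((Fin (d + 1) → ℝ) × ℝ) →ₗ[ℝ] ℝ := LinearMap.snd ℝ _ _
  have hdeg : ∀ y, deg y = y.2 := fun y => rfl
  let s := PyrAux.sl x
  let pr := PyrAux.prj x
  let C := PyrAux.coneOf P
  let Lf : Set ((Fin (d + 1) → ℝ) × ℝ) := {y | IsLatticePt y.1 ∧ 0 ≤ s y}
  let L0 : Set ((Fin (d + 1) → ℝ) × ℝ) := {y | IsLatticePt y.1 ∧ s y = 0}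
  let L1 : Set ((Fin (d + 1) → ℝ) × ℝ) := {y | IsLatticePt y.1 ∧ 0 < s y ∧ s y < r}
  -- lattice facts
  have hadd : ∀ m : ℕ, ∀ a b : Fin m → ℝ, IsLatticePt a → IsLatticePt b → IsLatticePt (a + b) := by
    intro m a b ha hb i
    obtain ⟨a', ha'⟩ := ha i
    obtain ⟨b', hb'⟩ := hb i
    exact ⟨a' + b', by simp [ha', hb']⟩
  have hneg : ∀ m : ℕ, ∀ a : Fin m → ℝ, IsLatticePt a → IsLatticePt (-a) := by
    intro m a ha i
    obtain ⟨a', ha'⟩ := ha i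
    exact ⟨-a', by simp [ha']⟩
  have hsnoc : ∀ y : Fin d → ℝ, IsLatticePt (Fin.snoc y 0 : Fin (d + 1) → ℝ) ↔ IsLatticePt y := by
    intro y
    constructor
    · intro h i
      simpa using h i.castSucc
    · intro h i
      refine Fin.lastCases ⟨0, by simp⟩ (fun i => ?_) i
      simpa using h i
  have hiff : ∀ a b : Fin (d + 1) → ℝ, IsLatticePt b → (IsLatticePt (a + b) ↔ IsLatticePt a) := by
    intro a b hb
    refine ⟨fun h => ?_, fun h => hadd _ _ _ h hb⟩
    have := hadd _ _ _ h (hneg _ _ hb)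
    simpa using this
  -- slices of the full set
  have hslice : ∀ k : ℕ, {y | y ∈ {y | y ∈ Lf ∧ pr y ∈ C} ∧ deg y = (k : ℝ)} =
      (fun m => (m, (k : ℝ))) '' {m ∈ (k : ℝ) • PyrAux.pyr P x | IsLatticePt m} := by
    intro k
    ext ⟨m, t⟩
    constructor
    · rintro ⟨⟨⟨h1, h2⟩, h3⟩, h4⟩
      have h4 : t = k := h4
      subst h4
      exact ⟨m, ⟨(PyrAux.mem_pyr P hPne hPc x hxo k k.cast_nonneg m).2 ⟨h2, h3⟩, h1⟩, rfl⟩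
    · rintro ⟨m', ⟨h1, h2⟩, h3⟩
      obtain ⟨rfl, rfl⟩ := Prod.mk.inj h3
      have := (PyrAux.mem_pyr P hPne hPc x hxo k k.cast_nonneg m').1 h1
      exact ⟨⟨⟨h2, this.1⟩, this.2⟩, rfl⟩
  have hfin : ∀ k : ℕ, {y | y ∈ {y | y ∈ Lf ∧ pr y ∈ C} ∧ deg y = (k : ℝ)}.Finite := by
    intro k
    rw [hslice]
    exact (PyrAux.lattice_finite _ (hpyrb.smul₀ _)).image _
  have hnn : ∀ y ∈ Lf, pr y ∈ C → 0 ≤ deg y := by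
    rintro y ⟨_, h1⟩ ⟨h2, _⟩
    have h2 : 0 ≤ y.2 - s y := h2
    rw [hdeg]; linarith
  have hL0f : L0 ⊆ Lf := fun y hy => ⟨hy.1, hy.2.ge⟩
  have hL1f : L1 ⊆ Lf := fun y hy => ⟨hy.1, hy.2.1.le⟩
  have hehrPyr : ehrSeries (PyrAux.pyr P x) = PyrAux.gs deg {y | y ∈ Lf ∧ pr y ∈ C} := by
    ext k
    rw [PyrAux.ehr_coeff _ hpyrne]
    simp only [PyrAux.gs, PowerSeries.coeff_mk]
    rw [hslice, Set.ncard_image_of_injective _ (fun a b h => (Prod.mk.inj h).1)]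
    rfl
  have hs0 : ∀ (y : Fin d → ℝ) (t : ℝ), s (Fin.snoc y 0, t) = 0 := by
    intro y t
    simp only [s, PyrAux.sl_apply, Fin.snoc_last, mul_zero]
  have hpr0 : ∀ (y : Fin d → ℝ) (t : ℝ), pr (Fin.snoc y 0, t) = (y, t) := by
    intro y t
    have := hs0 y t
    simp only [s] at this
    simp [pr, PyrAux.prj_apply, this]
  have hehrP : ehrSeries P = PyrAux.gs deg {y | y ∈ L0 ∧ pr y ∈ C} := by
    ext k
    rw [PyrAux.ehr_coeff _ hPne]
    simp only [PyrAux.gs, PowerSeries.coeff_mk]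
    have : {y | y ∈ {y | y ∈ L0 ∧ pr y ∈ C} ∧ deg y = (k : ℝ)} =
        (fun m : Fin d → ℝ => ((Fin.snoc m 0 : Fin (d + 1) → ℝ), (k : ℝ))) ''
          {m ∈ (k : ℝ) • P | IsLatticePt m} := by
      ext ⟨m, t⟩
      constructor
      · rintro ⟨⟨⟨h1, h2⟩, h3⟩, h4⟩
        have h4 : t = k := h4
        subst h4
        have hml : m (Fin.last d) = 0 := by
          have h2 : (x (Fin.last d))⁻¹ * m (Fin.last d) = 0 := h2
          exact (mul_eq_zero.1 h2).resolve_left (inv_ne_zero hxo)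
        have hm : m = (Fin.snoc (fun i : Fin d => m i.castSucc) 0 : Fin (d + 1) → ℝ) := by
          funext i
          refine Fin.lastCases ?_ (fun i => ?_) i
          · simp [hml]
          · simp
        rw [hm, hpr0] at h3
        simp only at h1
        rw [hm, hsnoc] at h1
        exact ⟨_, ⟨h3.2, h1⟩, Prod.ext hm.symm rfl⟩
      · rintro ⟨m', ⟨h1, h2⟩, h3⟩
        obtain ⟨rfl, rfl⟩ := Prod.mk.inj h3
        refine ⟨⟨⟨(hsnoc _).2 h2, hs0 _ _⟩, ?_⟩, rfl⟩
        rw [hpr0]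
        exact ⟨k.cast_nonneg, h1⟩
    rw [this, Set.ncard_image_of_injective]
    · rfl
    · intro a b h
      have := (Prod.mk.inj h).1
      funext i
      simpa using congrFun this i.castSucc
  -- data for the cone lemma
  let w : V → (Fin d → ℝ) × ℝ := fun v => ((v : Fin d → ℝ), (q : ℝ))
  let g : V → (Fin (d + 1) → ℝ) × ℝ := fun v => (Fin.snoc (v : Fin d → ℝ) 0, (q : ℝ))
  have hC := PyrAux.mem_coneOf P hPne hq0 V hV
  have hspan : Submodule.span ℝ (Set.range w) = ⊤ := by
    refine PyrAux.span_top P hfull _ ?_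
    intro z hz
    obtain ⟨a, -, rfl⟩ := (hC z).1 hz
    exact Submodule.sum_mem _ fun i _ =>
      Submodule.smul_mem _ _ (Submodule.subset_span ⟨i, rfl⟩)
  have hfr : Module.finrank ℝ ((Fin d → ℝ) × ℝ) = d + 1 := by simp
  have hsg : ∀ (y) (i : V), s (y + g i) = s y := by
    intro y i
    rw [map_add, hs0, add_zero]
  have hLg : ∀ (y : (Fin (d + 1) → ℝ) × ℝ) (i : V),
      IsLatticePt (y + g i).1 ↔ IsLatticePt y.1 :=
    fun y i => hiff _ _ ((hsnoc _).2 (hVl _ i.2))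
  have key : ∀ L : Set ((Fin (d + 1) → ℝ) × ℝ), (∀ y (i : V), y + g i ∈ L ↔ y ∈ L) →
      L ⊆ Lf → (∀ y ∈ L, s y ≤ r) → ∃ h : Polynomial ℤ, (h : PowerSeries ℤ) =
      (1 - PowerSeries.X ^ q) ^ (d + 1) * PyrAux.gs deg {y | y ∈ L ∧ pr y ∈ C} ∧
        ∀ i, 0 ≤ h.coeff i := by
    intro L hL hLf hLr
    refine PyrAux.cone_series (w := w) (LinearMap.snd ℝ _ _) hq0 (fun i => rfl) hspan hfr pr deg g
      (fun i => hpr0 _ _) (fun i => rfl) L hL r ?_ C hC ?_ ?_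
    · intro y hy
      have := hLr y hy
      change y.2 ≤ (y.2 - s y) + r
      linarith
    · intro k
      exact (hfin k).subset fun y hy => ⟨⟨hLf hy.1.1, hy.1.2⟩, hy.2⟩
    · intro y hy
      exact hnn y (hLf hy)
  obtain ⟨h0, hh0, -⟩ := key L0 (fun y i => by
    simp only [L0, Set.mem_ofPred_eq, hLg, hsg]) hL0f (fun y hy => by rw [hy.2]; exact hr'.le)
  obtain ⟨h1, hh1, hh1n⟩ := key L1 (fun y i => by
    simp only [L1, Set.mem_ofPred_eq, hLg, hsg]) hL1f (fun y hy => hy.2.2.le)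
  -- the apex shift
  let v : (Fin (d + 1) → ℝ) × ℝ := ((r : ℝ) • x, (r : ℝ))
  have hvl : IsLatticePt v.1 := fun i => by
    obtain ⟨a, ha⟩ := hxr i
    exact ⟨a, by simpa [v] using ha⟩
  have hsv : s v = r := by
    simp only [s, PyrAux.sl_apply, v, Pi.smul_apply, smul_eq_mul]
    field_simp
  have hprv : pr v = 0 := by
    have h := hsv
    simp only [s] at h
    simp only [pr, PyrAux.prj_apply, h]
    ext1
    · funext i; simp [v]
    · simp [v]
  have hshift := PyrAux.gs_shift deg {y | y ∈ Lf ∧ pr y ∈ C} v r rfl (by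
    rintro y ⟨⟨a1, a2⟩, a3⟩
    refine ⟨⟨hadd _ _ _ a1 hvl, ?_⟩, ?_⟩
    · rw [map_add, hsv]; linarith
    · rw [map_add, hprv, add_zero]; exact a3) hfin (fun y hy => hnn y hy.1 hy.2)
  have hsplit := PyrAux.gs_add deg
    {y | y ∈ {y | y ∈ Lf ∧ pr y ∈ C} ∧ y - v ∉ {y | y ∈ Lf ∧ pr y ∈ C}}
    {y | y ∈ L0 ∧ pr y ∈ C} {y | y ∈ L1 ∧ pr y ∈ C} (by
      ext y
      have e1 : IsLatticePt (y - v).1 ↔ IsLatticePt y.1 := by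
        rw [← hiff (y - v).1 v.1 hvl]
        simp
      simp only [Set.mem_union, Set.mem_ofPred_eq, Lf, L0, L1, map_sub, hprv, hsv, sub_zero, e1]
      constructor
      · rintro ⟨⟨⟨a1, a2⟩, a3⟩, a4⟩
        have a5 : s y < r := by
          by_contra hcon
          exact a4 ⟨⟨a1, by linarith⟩, a3⟩
        rcases a2.eq_or_lt with h | h
        · exact Or.inl ⟨⟨a1, h.symm⟩, a3⟩
        · exact Or.inr ⟨⟨a1, h, a5⟩, a3⟩
      · rintro (⟨⟨a1, a2⟩, a3⟩ | ⟨⟨a1, a2, a4⟩, a3⟩)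
        · exact ⟨⟨⟨a1, a2.ge⟩, a3⟩, fun h => by linarith [h.1.2]⟩
        · exact ⟨⟨⟨a1, a2.le⟩, a3⟩, fun h => by linarith [h.1.2]⟩)
    (by
      rw [Set.disjoint_left]
      rintro y ⟨⟨_, a⟩, _⟩ ⟨⟨_, b, _⟩, _⟩
      linarith)
    (fun k => (hfin k).subset fun y hy => ⟨hy.1.1, hy.2⟩)
  refine ⟨h0, h0 + h1, ?_, ?_, ?_⟩
  · rw [hh0, hehrP]
  · rw [hehrPyr, mul_assoc, hshift, hsplit, mul_add, Polynomial.coe_add, hh0, hh1]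
  · intro i
    rw [Polynomial.coeff_add]
    linarith [hh1n i]
end

section
/- Let P ⊂ ℝ^d be a full-dimensional rational reflexive polytope with denominator q. Then h*_P(z) = (1 + z + ⋯ + z^{q−1})·h*_{∂P}(z). -/
open Pointwise

theorem lat_finite {d : ℕ} {S : Set (Fin d → ℝ)} (hS : Bornology.IsBounded S) :
    {x ∈ S | IsLatticePt x}.Finite := by
  obtain ⟨R, hR⟩ := hS.subset_closedBall 0
  refine ((Set.finite_Icc (fun _ : Fin d => -⌈R⌉) (fun _ => ⌈R⌉)).image
    (fun (a : Fin d → ℤ) => fun i => (a i : ℝ))).subset ?_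
  rintro x ⟨hx, hl⟩
  choose a ha using hl
  have h1 := hR hx
  rw [mem_closedBall_zero_iff] at h1
  have h2 : ∀ i, |(a i : ℝ)| ≤ (⌈R⌉ : ℝ) := by
    intro i
    have := norm_le_pi_norm x i
    rw [ha i, Real.norm_eq_abs] at this
    exact this.trans (h1.trans (Int.le_ceil R))
  refine ⟨a, ⟨fun i => ?_, fun i => ?_⟩, ?_⟩
  · have := (abs_le.1 (h2 i)).1
    exact_mod_cast this
  · have := (abs_le.1 (h2 i)).2
    exact_mod_cast this
  · funext i
    exact (ha i).symm

/-- The dilated system of inequalities. -/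
def ineqSet {d m : ℕ} (A : Fin m → Fin d → ℤ) (t : ℝ) : Set (Fin d → ℝ) :=
  {x : Fin d → ℝ | ∀ j, (∑ i, (A j i : ℝ) * x i) ≤ t}

theorem sum_smul_eq {d m : ℕ} (A : Fin m → Fin d → ℤ) (c : ℝ) (x : Fin d → ℝ) (j : Fin m) :
    (∑ i, (A j i : ℝ) * (c • x) i) = c * ∑ i, (A j i : ℝ) * x i := by
  rw [Finset.mul_sum]
  refine Finset.sum_congr rfl fun i _ => ?_
  simp only [Pi.smul_apply, smul_eq_mul]
  ring

theorem smul_ineq {d m : ℕ} (A : Fin m → Fin d → ℤ) {t : ℝ} (ht : 0 < t) :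
    t • ineqSet A 1 = ineqSet A t := by
  ext x
  rw [Set.mem_smul_set_iff_inv_smul_mem₀ ht.ne']
  simp only [ineqSet, Set.mem_ofPred_eq, sum_smul_eq]
  refine forall_congr' fun j => ?_
  rw [inv_mul_le_iff₀ ht, mul_one]

theorem ineq_zero {d m : ℕ} (A : Fin m → Fin d → ℤ) (hb : Bornology.IsBounded (ineqSet A 1)) :
    ineqSet A 0 = {0} := by
  ext x
  constructor
  · intro hx
    obtain ⟨R, hR⟩ := hb.subset_closedBall 0
    by_contra hne
    have hpos : 0 < ‖x‖ := norm_pos_iff.2 hne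
    have hmem : ((|R| + 1) / ‖x‖) • x ∈ ineqSet A 1 := by
      intro j
      rw [sum_smul_eq]
      have h1 : (0:ℝ) ≤ (|R| + 1) / ‖x‖ := by positivity
      have := mul_nonpos_of_nonneg_of_nonpos h1 (hx j)
      linarith
    have := hR hmem
    rw [mem_closedBall_zero_iff, norm_smul, Real.norm_of_nonneg (by positivity),
      div_mul_cancel₀ _ hpos.ne'] at this
    linarith [le_abs_self R]
  · rintro rfl j
    simp

theorem interior_ineq {d m : ℕ} (A : Fin m → Fin d → ℤ) {t : ℝ} (ht : 0 < t) :
    interior (ineqSet A t) = {x | ∀ j, (∑ i, (A j i : ℝ) * x i) < t} := by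
  apply Set.Subset.antisymm
  · intro x hx j
    have hle := interior_subset hx j
    refine lt_of_le_of_ne hle fun heq => ?_
    have hc : Filter.Tendsto (fun c : ℝ => c • x) (nhdsWithin 1 (Set.Ioi 1)) (nhds x) := by
      have : Continuous (fun c : ℝ => c • x) := by fun_prop
      have h := this.tendsto 1
      rw [one_smul] at h
      exact h.mono_left nhdsWithin_le_nhds
    have h1 := hc.eventually (mem_interior_iff_mem_nhds.1 hx)
    obtain ⟨c, hcS, hc1⟩ := (h1.and self_mem_nhdsWithin).exists
    have h2 := hcS j
    rw [sum_smul_eq, heq] at h2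
    have : (1:ℝ) < c := hc1
    nlinarith
  · refine interior_maximal (fun x hx j => (hx j).le) ?_
    rw [Set.ofPred_forall]
    refine isOpen_iInter_of_finite fun j => ?_
    exact isOpen_lt (by fun_prop) continuous_const

theorem interior_lat {d m : ℕ} (A : Fin m → Fin d → ℤ) (n : ℕ) :
    {x ∈ interior (ineqSet A ((n + 1 : ℕ) : ℝ)) | IsLatticePt x}
      = {x ∈ ineqSet A (n : ℝ) | IsLatticePt x} := by
  rw [interior_ineq A (by positivity)]
  ext x
  simp only [Set.mem_ofPred_eq, ineqSet]
  refine and_congr_left fun hl => forall_congr' fun j => ?_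
  choose a ha using hl
  have : (∑ i, (A j i : ℝ) * x i) = ((∑ i, A j i * a i : ℤ) : ℝ) := by
    push_cast
    exact Finset.sum_congr rfl fun i _ => by rw [ha i]
  rw [this]
  have e1 : (((n + 1 : ℕ) : ℝ)) = (((n : ℤ) + 1 : ℤ) : ℝ) := by push_cast; rfl
  have e2 : ((n : ℝ)) = ((n : ℤ) : ℝ) := by push_cast; rfl
  rw [e1, e2, Int.cast_lt, Int.cast_le, Int.lt_add_one_iff]

theorem ineq_closed {d m : ℕ} (A : Fin m → Fin d → ℤ) (t : ℝ) : IsClosed (ineqSet A t) := by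
  rw [ineqSet, Set.ofPred_forall]
  exact isClosed_iInter fun j => isClosed_le (by fun_prop) continuous_const

theorem latCount_split {d : ℕ} {S : Set (Fin d → ℝ)} (hS : Bornology.IsBounded S)
    (hc : IsClosed S) : latCount S = latCount (interior S) + latCount (frontier S) := by
  unfold latCount
  rw [← Set.ncard_union_eq ?_ (lat_finite (hS.subset interior_subset))
    (lat_finite (hS.subset hc.frontier_subset))]
  · congr 1
    ext x
    have : x ∈ S ↔ x ∈ interior S ∨ x ∈ frontier S := by
      rw [hc.frontier_eq, Set.mem_sdiff]
      have := @interior_subset _ _ S x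
      tauto
    simp only [Set.mem_union, Set.mem_ofPred_eq, this]
    tauto
  · rw [Set.disjoint_left]
    rintro x ⟨h1, -⟩ ⟨h2, -⟩
    exact h2.2 h1

theorem ehr_eq {d : ℕ} (P : Set (Fin d → ℝ)) (hrefl : IsRationalReflexive P) :
    ehrBdSeries P = (1 - PowerSeries.X) * ehrSeries P := by
  obtain ⟨⟨V, -, hV⟩, -, m, A, hA⟩ := hrefl
  have hb : Bornology.IsBounded P := by
    rw [hV]
    exact (isBounded_convexHull).2 V.finite_toSet.isBounded
  change P = ineqSet A 1 at hA
  subst hA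
  have key : ∀ n : ℕ, (PowerSeries.coeff n) (ehrSeries (ineqSet A 1))
      = (latCount (ineqSet A (n : ℝ)) : ℤ) := by
    intro n
    rw [ehrSeries, PowerSeries.coeff_mk]
    rcases Nat.eq_zero_or_pos n with rfl | hn
    · rw [if_pos rfl, Nat.cast_zero, ineq_zero A hb, latCount]
      have : {x ∈ ({0} : Set (Fin d → ℝ)) | IsLatticePt x} = {0} := by
        ext x
        simp only [Set.mem_ofPred_eq, Set.mem_singleton_iff, and_iff_left_iff_imp]
        rintro rfl i
        exact ⟨0, by simp⟩
      rw [this, Set.ncard_singleton]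
      rfl
    · rw [if_neg hn.ne', smul_ineq A (by exact_mod_cast hn)]
  ext n
  rw [sub_mul, one_mul, map_sub, key]
  cases n with
  | zero =>
    have := key 0
    rw [← this]
    simp [ehrBdSeries, ehrSeries]
  | succ n =>
    rw [mul_comm, PowerSeries.coeff_succ_mul_X, key, ehrBdSeries, PowerSeries.coeff_mk,
      if_neg n.succ_ne_zero]
    have hpos : (0:ℝ) < ((n + 1 : ℕ) : ℝ) := by positivity
    have hbd : Bornology.IsBounded (ineqSet A ((n + 1 : ℕ) : ℝ)) := by
      rw [← smul_ineq A hpos]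
      exact hb.smul₀ _
    have h1 := latCount_split hbd (ineq_closed A _)
    have h2 : latCount (interior (ineqSet A ((n + 1 : ℕ) : ℝ))) = latCount (ineqSet A (n : ℝ)) := by
      unfold latCount
      rw [interior_lat]
    rw [smul_ineq A hpos, h1, h2]
    push_cast
    ring

/-- **Statement 12.** If `P ⊆ ℝ^d` is a full-dimensional rational reflexive polytope with
denominator `q`, then `h*_P(z) = (1 + z + ⋯ + z^{q−1}) h*_{∂P}(z)`. -/
theorem rational_reflexive_hstar {d q : ℕ} (P : Set (Fin d → ℝ))
    (hfull : IsFullDim P) (hrefl : IsRationalReflexive P) (hq : IsDenominator P q)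
    (hP : Polynomial ℤ) (hPdeg : hP.natDegree < q * (d + 1))
    (hPeq : (hP : PowerSeries ℤ) = (1 - PowerSeries.X ^ q) ^ (d + 1) * ehrSeries P)
    (hB : Polynomial ℤ)
    (hBeq : (hB : PowerSeries ℤ) = (1 - PowerSeries.X ^ q) ^ d * ehrBdSeries P) :
    hP = (∑ i ∈ Finset.range q, (Polynomial.X : Polynomial ℤ) ^ i) * hB := by
  apply Polynomial.coe_injective
  rw [Polynomial.coe_mul, hPeq, hBeq, ehr_eq P hrefl]
  have hg : ((∑ i ∈ Finset.range q, (Polynomial.X : Polynomial ℤ) ^ i : Polynomial ℤ) :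
      PowerSeries ℤ) * (1 - PowerSeries.X) = 1 - PowerSeries.X ^ q := by
    have := congrArg (fun p : Polynomial ℤ => (p : PowerSeries ℤ))
      (geom_sum_mul_neg (Polynomial.X : Polynomial ℤ) q)
    simpa using this
  rw [pow_succ]
  nth_rewrite 2 [← hg]
  ring
end
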